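/- Let 0 < R ≤ 1, M ≥ 0, σ > 0. Let ρ_r be an even 2-periodic probability density, let ρ : [0,∞) × ℝ → ℝ be a classical solution of the Fokker–Planck equation ∂_t ρ(t,x) = ∂_x(ρ(t,x) G_{ρ(t,·)}(x)) + (σ²/2) ∂²_x ρ(t,x) such that ρ(t,·) is an even 2-periodic probability density for every t ≥ 0, and let ρˢ be a twice continuously differentiable even 2-periodic probability density solving the stationary equation (σ²/2)(ρˢ)'' + (ρˢ G_{ρˢ})' = 0. Set C* = 2R(3+M) + (2R²/√3) exp(8R(1+M)/σ²). Then for all t ≥ 0, ∫_{-1}^{1} (ρ(t,x) − ρˢ(x))² dx ≤ (∫_{-1}^{1} (ρ(0,x) − ρˢ(x))² dx) · exp( (2C*²/σ² − π²σ²/2) t ). In particular, if 2C*²/σ² < π²σ²/2 then ρ(t,·) converges to ρˢ exponentially fast in L²([-1,1]). -/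

import Mathlib

open MeasureTheory Real

/-- The influence field `G_ρ(x) = ∫_{x-R}^{x+R} (x-y)(ρ(y) + M ρ_r(y)) dy`. -/
noncomputable def G (R M : ℝ) (ρ ρr : ℝ → ℝ) (x : ℝ) : ℝ :=
  ∫ y in (x - R)..(x + R), (x - y) * (ρ y + M * ρr y)

/-- `f` is an even 2-periodic probability density. -/
def IsEvenPeriodicDensity (f : ℝ → ℝ) : Prop :=
  (∀ x, f (x + 2) = f x) ∧ (∀ x, f (-x) = f x) ∧ (∀ x, 0 ≤ f x) ∧
    (∫ x in (0:ℝ)..1, f x) = 1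

/-- `ρ : (t,x) ↦ ρ(t,x)` is a classical solution of the Fokker–Planck equation
`∂_t ρ = ∂_x (ρ G_ρ) + (σ²/2) ∂²_x ρ`: it is continuous in `(t,x)`, continuously
differentiable in `t` and twice continuously differentiable in `x` for `t > 0`,
and satisfies the PDE pointwise for `t > 0`. -/
def IsClassicalSolution (R M σ : ℝ) (ρr : ℝ → ℝ) (ρ : ℝ → ℝ → ℝ) : Prop :=
  Continuous (Function.uncurry ρ) ∧
  (∀ t : ℝ, 0 < t → ∀ x : ℝ, ContDiffAt ℝ 1 (fun s => ρ s x) t) ∧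
  (∀ t : ℝ, 0 < t → ContDiff ℝ 2 (ρ t)) ∧
  (∀ t : ℝ, 0 < t → ∀ x : ℝ,
    deriv (fun s => ρ s x) t =
      deriv (fun y => ρ t y * G R M (ρ t) ρr y) x
        + σ ^ 2 / 2 * deriv (deriv (ρ t)) x)

section
open Set Filter Topology intervalIntegral

theorem IsEvenPeriodicDensity.intervalIntegrable {f : ℝ → ℝ} (hf : IsEvenPeriodicDensity f)
    (a b : ℝ) : IntervalIntegrable f volume a b := by
  obtain ⟨hp, he, -, h1⟩ := hf
  have h01 : IntervalIntegrable f volume 0 1 := by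
    by_contra h
    rw [intervalIntegral.integral_undef h] at h1
    norm_num at h1
  have h10 : IntervalIntegrable f volume (-1) 0 := by
    have h := (IntervalIntegrable.iff_comp_neg).1 h01
    simp only [he, neg_zero] at h
    exact h.symm
  refine Function.Periodic.intervalIntegrable (T := 2) hp (by norm_num) (t := -1) ?_ a b
  have := h10.trans h01
  norm_num
  exact this

theorem IsEvenPeriodicDensity.integral_neg_one_one {f : ℝ → ℝ} (hf : IsEvenPeriodicDensity f) :
    ∫ x in (-1 : ℝ)..1, f x = 2 := by
  rw [← integral_add_adjacent_intervals (hf.intervalIntegrable (-1) 0)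
    (hf.intervalIntegrable 0 1)]
  have h : ∫ x in (-1 : ℝ)..0, f x = ∫ x in (0 : ℝ)..1, f x := by
    have := intervalIntegral.integral_comp_neg (a := 0) (b := 1) f
    simp only [hf.2.1, neg_zero] at this
    exact this.symm
  rw [h, hf.2.2.2]; norm_num

theorem IsEvenPeriodicDensity.integral_window {f : ℝ → ℝ} (hf : IsEvenPeriodicDensity f) (x : ℝ) :
    ∫ y in (x - 1)..(x + 1), f y = 2 := by
  have h := Function.Periodic.intervalIntegral_add_eq (f := f) (T := 2) hf.1 (x - 1) (-1)
  rw [show x - 1 + 2 = x + 1 by ring, show (-1 : ℝ) + 2 = 1 by norm_num] at h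
  rw [h, hf.integral_neg_one_one]

/-- The primitive of a locally integrable function, shifted, is absolutely continuous. -/
theorem absolutelyContinuousOnInterval_primitive_shift {h : ℝ → ℝ}
    (hh : ∀ a b, IntervalIntegrable h volume a b) (c a b : ℝ) :
    AbsolutelyContinuousOnInterval (fun x => ∫ y in (0 : ℝ)..(x + c), h y) a b := by
  have hint : IntervalIntegrable (fun y => h (y + c)) volume a b := by
    have := (hh (a + c) (b + c)).comp_add_right c
    simpa using this
  have h1 := hint.absolutelyContinuousOnInterval_intervalIntegral (c := a) left_mem_uIcc
  have h2 : AbsolutelyContinuousOnInterval (fun _ : ℝ => ∫ y in (0 : ℝ)..(a + c), h y) a b :=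
    ContDiffOn.absolutelyContinuousOnInterval contDiffOn_const
  have e : (fun x => ∫ y in (0 : ℝ)..(x + c), h y) =
      fun x => (∫ y in (0 : ℝ)..(a + c), h y) + ∫ v in a..x, h (v + c) := by
    ext x
    rw [intervalIntegral.integral_comp_add_right]
    exact (integral_add_adjacent_intervals (hh _ _) (hh _ _)).symm
  rw [e]
  exact h2.fun_add h1

theorem window_eq {h : ℝ → ℝ} (hh : ∀ a b, IntervalIntegrable h volume a b) (R x : ℝ) :
    ∫ y in (x - R)..(x + R), (x - y) * h y =
      x * ((∫ y in (0 : ℝ)..(x + R), h y) - ∫ y in (0 : ℝ)..(x + -R), h y)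
        - ((∫ y in (0 : ℝ)..(x + R), y * h y) - ∫ y in (0 : ℝ)..(x + -R), y * h y) := by
  have hy : ∀ a b, IntervalIntegrable (fun y => y * h y) volume a b := fun a b =>
    (hh a b).continuousOn_mul continuous_id.continuousOn
  rw [integral_interval_sub_left (hh _ _) (hh _ _), integral_interval_sub_left (hy _ _) (hy _ _),
    ← intervalIntegral.integral_const_mul, ← sub_eq_add_neg,
    ← intervalIntegral.integral_sub ((hh _ _).const_mul _) (hy _ _)]
  congr 1; ext y; ring

theorem window_absolutelyContinuous {h : ℝ → ℝ} (hh : ∀ a b, IntervalIntegrable h volume a b)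
    (R a b : ℝ) :
    AbsolutelyContinuousOnInterval (fun x => ∫ y in (x - R)..(x + R), (x - y) * h y) a b := by
  have hy : ∀ a b, IntervalIntegrable (fun y => y * h y) volume a b := fun a b =>
    (hh a b).continuousOn_mul continuous_id.continuousOn
  simp_rw [window_eq hh R]
  have hid : AbsolutelyContinuousOnInterval (fun x : ℝ => x) a b :=
    ContDiffOn.absolutelyContinuousOnInterval contDiffOn_id
  exact (hid.fun_mul ((absolutelyContinuousOnInterval_primitive_shift hh R a b).fun_sub
    (absolutelyContinuousOnInterval_primitive_shift hh (-R) a b))).fun_sub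
    ((absolutelyContinuousOnInterval_primitive_shift hy R a b).fun_sub
    (absolutelyContinuousOnInterval_primitive_shift hy (-R) a b))

theorem window_continuous {h : ℝ → ℝ} (hh : ∀ a b, IntervalIntegrable h volume a b) (R : ℝ) :
    Continuous (fun x => ∫ y in (x - R)..(x + R), (x - y) * h y) := by
  have hy : ∀ a b, IntervalIntegrable (fun y => y * h y) volume a b := fun a b =>
    (hh a b).continuousOn_mul continuous_id.continuousOn
  simp_rw [window_eq hh R]
  have h1 := continuous_primitive hh 0
  have h2 := continuous_primitive hy 0
  have h3 := fun c : ℝ => h1.comp (continuous_add_const c)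
  have h4 := fun c : ℝ => h2.comp (continuous_add_const c)
  exact (continuous_id.mul ((h3 R).sub (h3 (-R)))).sub ((h4 R).sub (h4 (-R)))

theorem window_shift (h : ℝ → ℝ) (R x : ℝ) :
    ∫ y in (x - R)..(x + R), (x - y) * h y = ∫ z in (-R)..R, -z * h (x + z) := by
  have := intervalIntegral.integral_comp_add_left (a := -R) (b := R) (fun y => (x - y) * h y) x
  rw [← sub_eq_add_neg] at this
  rw [← this]
  congr 1; ext z; ring

/-- The derivative of a window integral of a continuous function. -/
theorem window_hasDerivAt {h : ℝ → ℝ} (hh : Continuous h) (R x : ℝ) :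
    HasDerivAt (fun x => ∫ y in (x - R)..(x + R), (x - y) * h y)
      ((∫ z in (-R)..R, h (x + z)) - R * (h (x + R) + h (x - R))) x := by
  have hi : ∀ a b, IntervalIntegrable h volume a b := fun a b => hh.intervalIntegrable a b
  have hyc : Continuous (fun y => y * h y) := by fun_prop
  simp_rw [window_eq hi R]
  have d1 : ∀ c : ℝ, HasDerivAt (fun x => ∫ y in (0 : ℝ)..(x + c), h y) (h (x + c)) x := fun c => by
    simpa using (hh.integral_hasStrictDerivAt 0 (x + c)).hasDerivAt.comp_add_const x c
  have d2 : ∀ c : ℝ, HasDerivAt (fun x => ∫ y in (0 : ℝ)..(x + c), y * h y)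
      ((x + c) * h (x + c)) x := fun c => by
    simpa using (hyc.integral_hasStrictDerivAt 0 (x + c)).hasDerivAt.comp_add_const x c
  refine (((hasDerivAt_id x).mul ((d1 R).sub (d1 (-R)))).sub ((d2 R).sub (d2 (-R)))).congr_deriv ?_
  have e : ∫ z in (-R)..R, h (x + z) =
      (∫ y in (0 : ℝ)..(x + R), h y) - ∫ y in (0 : ℝ)..(x + -R), h y := by
    rw [integral_interval_sub_left (hi _ _) (hi _ _), intervalIntegral.integral_comp_add_left]
  simp only [id, Pi.sub_apply, sub_eq_add_neg] at *
  rw [e]; ring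

theorem IsEvenPeriodicDensity.add_mul_intervalIntegrable {f g : ℝ → ℝ}
    (hf : IsEvenPeriodicDensity f) (hg : IsEvenPeriodicDensity g) (M a b : ℝ) :
    IntervalIntegrable (fun y => f y + M * g y) volume a b :=
  (hf.intervalIntegrable a b).add ((hg.intervalIntegrable a b).const_mul M)

theorem G_continuous {R M : ℝ} {f g : ℝ → ℝ} (hf : IsEvenPeriodicDensity f)
    (hg : IsEvenPeriodicDensity g) : Continuous (G R M f g) :=
  window_continuous (hf.add_mul_intervalIntegrable hg M) R

theorem G_periodic {R M : ℝ} {f g : ℝ → ℝ} (hf : IsEvenPeriodicDensity f)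
    (hg : IsEvenPeriodicDensity g) : Function.Periodic (G R M f g) 2 := by
  intro x
  simp only [G]
  rw [window_shift (fun y => f y + M * g y), window_shift (fun y => f y + M * g y)]
  congr 1; ext z
  rw [show x + 2 + z = x + z + 2 by ring, hf.1, hg.1]

theorem G_zero {R M : ℝ} {f g : ℝ → ℝ} (hf : IsEvenPeriodicDensity f)
    (hg : IsEvenPeriodicDensity g) : G R M f g 0 = 0 := by
  have h := intervalIntegral.integral_comp_neg (a := -R) (b := R)
    (fun y => (0 - y) * (f y + M * g y))
  simp only [hf.2.1, hg.2.1, neg_neg] at h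
  have h2 : ∫ y in (-R)..R, (0 - -y) * (f y + M * g y)
      = -∫ y in (-R)..R, (0 - y) * (f y + M * g y) := by
    rw [← intervalIntegral.integral_neg]; congr 1; ext y; ring
  simp only [G, zero_sub, zero_add]
  simp only [zero_sub] at h h2
  linarith

theorem abs_G_le {R M : ℝ} (hR : 0 < R) (hR1 : R ≤ 1) (hM : 0 ≤ M) {f g : ℝ → ℝ}
    (hf : IsEvenPeriodicDensity f) (hg : IsEvenPeriodicDensity g) (x : ℝ) :
    |G R M f g x| ≤ 2 * R * (1 + M) := by
  have hi := hf.add_mul_intervalIntegrable hg M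
  have hnn : ∀ y, 0 ≤ f y + M * g y := fun y => add_nonneg (hf.2.2.1 y) (mul_nonneg hM (hg.2.2.1 y))
  calc |G R M f g x| ≤ ∫ y in (x - R)..(x + R), R * (f y + M * g y) := by
        rw [← Real.norm_eq_abs]
        refine intervalIntegral.norm_integral_le_of_norm_le (by linarith) ?_ ((hi _ _).const_mul R)
        refine Eventually.of_forall fun y hy => ?_
        rw [norm_mul, Real.norm_eq_abs, Real.norm_eq_abs, abs_of_nonneg (hnn y)]
        refine mul_le_mul_of_nonneg_right ?_ (hnn y)
        rw [abs_le]; constructor <;> linarith [hy.1, hy.2]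
    _ = R * ∫ y in (x - R)..(x + R), (f y + M * g y) := intervalIntegral.integral_const_mul _ _
    _ ≤ R * ∫ y in (x - 1)..(x + 1), (f y + M * g y) := by
        refine mul_le_mul_of_nonneg_left ?_ hR.le
        exact intervalIntegral.integral_mono_interval (by linarith) (by linarith) (by linarith)
          (Eventually.of_forall hnn) (hi _ _)
    _ = 2 * R * (1 + M) := by
        rw [intervalIntegral.integral_add (hf.intervalIntegrable _ _)
          ((hg.intervalIntegrable _ _).const_mul M), intervalIntegral.integral_const_mul,
          hf.integral_window, hg.integral_window]
        ring

/-- The influence fields of two densities differ by the window integral of their difference. -/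
theorem G_sub {R M : ℝ} {f g k : ℝ → ℝ} (hf : IsEvenPeriodicDensity f)
    (hk : IsEvenPeriodicDensity k) (hg : IsEvenPeriodicDensity g) (x : ℝ) :
    G R M f g x = G R M k g x + ∫ y in (x - R)..(x + R), (x - y) * (f y - k y) := by
  have h1 := fun a b => (hf.add_mul_intervalIntegrable hg M a b).continuousOn_mul
    (g := fun y => x - y) (by fun_prop)
  have h2 := fun a b => (hk.add_mul_intervalIntegrable hg M a b).continuousOn_mul
    (g := fun y => x - y) (by fun_prop)
  have h3 : ∫ y in (x - R)..(x + R), (x - y) * (f y - k y) = G R M f g x - G R M k g x := by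
    simp only [G]
    rw [← intervalIntegral.integral_sub (h1 _ _) (h2 _ _)]
    congr 1; ext y; ring
  rw [h3]; ring

section Stationary

variable {R M H : ℝ} {ρr ρs : ℝ → ℝ}

/-- A stationary density carries no flux. -/
theorem stationary_flux (hρr : IsEvenPeriodicDensity ρr) (hρs : ContDiff ℝ 2 ρs)
    (hρsd : IsEvenPeriodicDensity ρs)
    (hstat : ∀ x : ℝ, H * deriv (deriv ρs) x + deriv (fun y => ρs y * G R M ρs ρr y) x = 0)
    (x : ℝ) : H * deriv ρs x + ρs x * G R M ρs ρr x = 0 := by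
  have hd1 : ContDiff ℝ 1 (deriv ρs) := by
    have : ContDiff ℝ (1 + 1) ρs := by simpa [one_add_one_eq_two] using hρs
    exact ((contDiff_succ_iff_deriv).1 this).2.2
  have hac : AbsolutelyContinuousOnInterval (fun y => ρs y * G R M ρs ρr y) 0 x :=
    (ContDiffOn.absolutelyContinuousOnInterval
      (hρs.of_le (by norm_num)).contDiffOn).fun_mul
      (window_absolutelyContinuous (hρsd.add_mul_intervalIntegrable hρr M) R 0 x)
  have hF := hac.integral_deriv_eq_sub
  have hac2 : AbsolutelyContinuousOnInterval (deriv ρs) 0 x :=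
    ContDiffOn.absolutelyContinuousOnInterval hd1.contDiffOn
  have hF2 := hac2.integral_deriv_eq_sub
  have he : ∀ y, deriv (fun y => ρs y * G R M ρs ρr y) y = -H * deriv (deriv ρs) y := fun y => by
    linarith [hstat y]
  simp_rw [he] at hF
  rw [intervalIntegral.integral_const_mul, hF2, G_zero hρsd hρr] at hF
  have h0 : deriv ρs 0 = 0 := by
    have h := deriv_comp_neg ρs 0
    simp only [hρsd.2.1, neg_zero] at h
    linarith
  rw [h0] at hF
  linarith

theorem stationary_eq_exp (hH : 0 < H) (hρs : ContDiff ℝ 2 ρs)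
    (hG : Continuous (G R M ρs ρr))
    (hflux : ∀ x, H * deriv ρs x + ρs x * G R M ρs ρr x = 0) (x : ℝ) :
    ρs x = ρs 0 * exp (-(∫ y in (0 : ℝ)..x, G R M ρs ρr y) / H) := by
  have hd : ∀ x, HasDerivAt (fun x => ρs x * exp ((∫ y in (0 : ℝ)..x, G R M ρs ρr y) / H)) 0 x := by
    intro x
    have h1 := ((hρs.differentiable (by norm_num)) x).hasDerivAt
    have h2 := (((hG.integral_hasStrictDerivAt 0 x).hasDerivAt).div_const H).exp
    refine (h1.mul h2).congr_deriv ?_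
    have : deriv ρs x = -(ρs x * G R M ρs ρr x) / H := by
      field_simp; linarith [hflux x]
    rw [this]; field_simp; ring
  have hc := is_const_of_deriv_eq_zero (fun x => (hd x).differentiableAt)
    (fun x => (hd x).deriv) x 0
  simp only [intervalIntegral.integral_same, zero_div, exp_zero, mul_one] at hc
  rw [← hc, mul_assoc, ← exp_add, neg_div, add_neg_cancel, exp_zero, mul_one]

theorem stationary_pos (hρsd : IsEvenPeriodicDensity ρs)
    (hexp : ∀ x, ρs x = ρs 0 * exp (-(∫ y in (0 : ℝ)..x, G R M ρs ρr y) / H)) (x : ℝ) :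
    0 < ρs x := by
  have h0 : ρs 0 ≠ 0 := by
    intro h
    have : ∀ x, ρs x = 0 := fun x => by rw [hexp, h, zero_mul]
    have h1 := hρsd.2.2.2
    simp [this] at h1
  have : 0 < ρs 0 := lt_of_le_of_ne (hρsd.2.2.1 0) h0.symm
  rw [hexp]; positivity

/-- The sup bound on the stationary density. -/
theorem stationary_le (hR : 0 < R) (hR1 : R ≤ 1) (hM : 0 ≤ M) (hH : 0 < H)
    (hρr : IsEvenPeriodicDensity ρr) (hρs : ContDiff ℝ 2 ρs)
    (hρsd : IsEvenPeriodicDensity ρs)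
    (hexp : ∀ x, ρs x = ρs 0 * exp (-(∫ y in (0 : ℝ)..x, G R M ρs ρr y) / H)) (x : ℝ) :
    ρs x ≤ exp (4 * R * (1 + M) / H) := by
  have hG : Continuous (G R M ρs ρr) := G_continuous hρsd hρr
  have hc : Continuous ρs := hρs.continuous
  have key : ∀ x ∈ Icc (-1 : ℝ) 1, ∀ y ∈ Icc (0 : ℝ) 1,
      ρs x ≤ ρs y * exp (4 * R * (1 + M) / H) := by
    intro x hx y hy
    have h0 : ρs x = ρs y * exp ((∫ z in x..y, G R M ρs ρr z) / H) := by
      rw [hexp x, hexp y, mul_assoc, ← exp_add,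
        ← integral_interval_sub_left (hG.intervalIntegrable 0 y) (hG.intervalIntegrable 0 x)]
      congr 2; ring
    rw [h0]
    refine mul_le_mul_of_nonneg_left (exp_le_exp.2 ?_) (hρsd.2.2.1 y)
    refine div_le_div_of_nonneg_right ?_ hH.le
    have h1 : ‖∫ z in x..y, G R M ρs ρr z‖ ≤ 2 * R * (1 + M) * |y - x| :=
      intervalIntegral.norm_integral_le_of_norm_le_const fun z _ => by
        rw [Real.norm_eq_abs]; exact abs_G_le hR hR1 hM hρsd hρr z
    have h2 : |y - x| ≤ 2 := by rw [abs_le]; constructor <;> linarith [hx.1, hx.2, hy.1, hy.2]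
    have h3 : 0 ≤ 2 * R * (1 + M) := by positivity
    calc _ ≤ ‖∫ z in x..y, G R M ρs ρr z‖ := le_abs_self _
      _ ≤ 2 * R * (1 + M) * |y - x| := h1
      _ ≤ 2 * R * (1 + M) * 2 := mul_le_mul_of_nonneg_left h2 h3
      _ = _ := by ring
  have key2 : ∀ x ∈ Icc (-1 : ℝ) 1, ρs x ≤ exp (4 * R * (1 + M) / H) := by
    intro x hx
    have h1 : ∫ _y in (0 : ℝ)..1, ρs x ≤ ∫ y in (0 : ℝ)..1, ρs y * exp (4 * R * (1 + M) / H) :=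
      intervalIntegral.integral_mono_on (by norm_num) (by simp)
        ((hc.mul continuous_const).intervalIntegrable _ _) (fun y hy => key x hx y hy)
    rw [intervalIntegral.integral_mul_const, hρsd.2.2.2] at h1
    simpa using h1
  obtain ⟨y, hy, hxy⟩ :=
    Function.Periodic.exists_mem_Ico (f := ρs) (c := 2) hρsd.1 (by norm_num) x (-1)
  rw [hxy]
  exact key2 y ⟨hy.1, by linarith [hy.2]⟩

end Stationary
end

section
open Set Filter Topology intervalIntegral

/-- A continuous function is controlled by an upper bound for its left Dini derivative. -/
theorem sub_le_integral_of_left_dini {m g : ℝ → ℝ} {s t : ℝ} (hst : s ≤ t) (hm : Continuous m)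
    (hg : Continuous g)
    (h : ∀ τ ∈ Ioc s t, ∀ r, g τ < r → ∃ᶠ k in 𝓝[>] (0 : ℝ), (m τ - m (τ - k)) / k < r) :
    m t - m s ≤ ∫ τ in s..t, g τ := by
  have hgn : Continuous (fun y => g (-y)) := hg.comp continuous_neg
  have hB : ∀ x, HasDerivAt (fun x => -m t + ∫ y in (-t)..x, g (-y)) (g (-x)) x := fun x =>
    ((hgn.integral_hasStrictDerivAt (-t) x).hasDerivAt).const_add _
  have key := image_le_of_liminf_slope_right_le_deriv_boundary (f := fun x => -m (-x))
    (a := -t) (b := -s) (B := fun x => -m t + ∫ y in (-t)..x, g (-y)) (B' := fun x => g (-x))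
    (by fun_prop) (by simp) (fun x _ => (hB x).continuousAt.continuousWithinAt)
    (fun x _ => (hB x).hasDerivWithinAt) ?_ (show -s ∈ Icc (-t) (-s) by constructor <;> linarith)
  · simp only [neg_neg, intervalIntegral.integral_comp_neg] at key
    linarith
  · intro x hx r hr
    have h1 := h (-x) ⟨by linarith [hx.2], by linarith [hx.1]⟩ r hr
    have hmap : Tendsto (fun k => x + k) (𝓝[>] (0 : ℝ)) (𝓝[>] x) := by
      refine tendsto_nhdsWithin_of_tendsto_nhds_of_eventually_within _ ?_ ?_
      · have : Tendsto (fun k : ℝ => x + k) (𝓝 0) (𝓝 (x + 0)) := by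
          exact (continuous_const.add continuous_id).tendsto 0
        rw [add_zero] at this
        exact this.mono_left nhdsWithin_le_nhds
      · filter_upwards [self_mem_nhdsWithin] with k hk
        simpa using hk
    refine hmap.frequently (h1.mono fun k hk => ?_)
    rw [slope_def_field]
    convert hk using 1
    rw [show -(x + k) = -x - k by ring]
    ring

/-- Gronwall's inequality for left Dini derivatives. -/
theorem le_exp_of_left_dini {E : ℝ → ℝ} {s t lam : ℝ} (hst : s ≤ t) (hE : Continuous E)
    (h : ∀ τ ∈ Ioc s t, ∀ r, lam * E τ < r → ∃ᶠ k in 𝓝[>] (0 : ℝ), (E τ - E (τ - k)) / k < r) :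
    E t ≤ E s * exp (lam * (t - s)) := by
  have key := le_gronwallBound_of_liminf_deriv_right_le (f := fun x => -E (-x))
    (f' := fun x => lam * E (-x)) (δ := -E t) (K := -lam) (ε := 0) (a := -t) (b := -s)
    (by fun_prop) ?_ (by simp) (fun x _ => by linarith) (-s)
    (show -s ∈ Icc (-t) (-s) by constructor <;> linarith)
  · rw [gronwallBound_ε0, neg_neg, show -s - -t = t - s by ring] at key
    have h2 : E t * exp (-lam * (t - s)) ≤ E s := by linarith
    have h3 := mul_le_mul_of_nonneg_right h2 (exp_pos (lam * (t - s))).le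
    rwa [mul_assoc, ← exp_add, show -lam * (t - s) + lam * (t - s) = 0 by ring, exp_zero,
      mul_one] at h3
  · intro x hx r hr
    have h1 := h (-x) ⟨by linarith [hx.2], by linarith [hx.1]⟩ r hr
    have hmap : Tendsto (fun k => x + k) (𝓝[>] (0 : ℝ)) (𝓝[>] x) := by
      refine tendsto_nhdsWithin_of_tendsto_nhds_of_eventually_within _ ?_ ?_
      · have : Tendsto (fun k : ℝ => x + k) (𝓝 0) (𝓝 (x + 0)) := by
          exact (continuous_const.add continuous_id).tendsto 0
        rw [add_zero] at this
        exact this.mono_left nhdsWithin_le_nhds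
      · filter_upwards [self_mem_nhdsWithin] with k hk
        simpa using hk
    refine hmap.frequently (h1.mono fun k hk => ?_)
    convert hk using 1
    rw [show -(x + k) = -x - k by ring]
    ring

theorem tendsto_central_difference {f : ℝ → ℝ} {f' y : ℝ} (hf : HasDerivAt f f' y) :
    Tendsto (fun h => (f (y + h) - f (y - h)) / (2 * h)) (𝓝[>] 0) (𝓝 f') := by
  have h1 : HasDerivAt (fun h => f (y + h) - f (y - h)) (f' - -f') 0 := by
    have ha : HasDerivAt (fun h => f (y + h)) f' 0 := by
      simpa using HasDerivAt.comp_const_add y 0 (by simpa using hf)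
    have hb : HasDerivAt (fun h => f (y - h)) (-f') 0 := by
      simpa using HasDerivAt.comp_const_sub y 0 (by simpa using hf)
    exact ha.sub hb
  have h2 := h1.tendsto_slope_zero_right.const_mul (1 / 2)
  rw [show 1 / 2 * (f' - -f') = f' by ring] at h2
  refine h2.congr' ?_
  filter_upwards [self_mem_nhdsWithin] with h hh
  have : h ≠ 0 := ne_of_gt hh
  simp only [zero_add, add_zero, sub_zero, sub_self, smul_eq_mul]
  field_simp

theorem tendsto_second_difference {f f1 : ℝ → ℝ} {f2 y : ℝ} (hf : ∀ x, HasDerivAt f (f1 x) x)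
    (hf1 : HasDerivAt f1 f2 y) :
    Tendsto (fun h => (f (y + h) + f (y - h) - 2 * f y) / h ^ 2) (𝓝[>] 0) (𝓝 f2) := by
  have hd : ∀ h, HasDerivAt (fun h => f (y + h) + f (y - h) - 2 * f y)
      (f1 (y + h) - f1 (y - h)) h := by
    intro h
    have ha : HasDerivAt (fun h => f (y + h)) (f1 (y + h)) h := (hf (y + h)).comp_const_add y h
    have hb : HasDerivAt (fun h => f (y - h)) (-f1 (y - h)) h := (hf (y - h)).comp_const_sub y h
    exact ((ha.add hb).sub_const (2 * f y)).congr_deriv (by ring)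
  have hp : ∀ h : ℝ, HasDerivAt (fun h : ℝ => h ^ 2) (2 * h) h := fun h => by
    simpa using hasDerivAt_pow 2 h
  refine HasDerivAt.lhopital_zero_nhdsGT (f' := fun h => f1 (y + h) - f1 (y - h))
    (g' := fun h => 2 * h) (Eventually.of_forall hd) (Eventually.of_forall hp) ?_ ?_ ?_
    (tendsto_central_difference hf1)
  · filter_upwards [self_mem_nhdsWithin] with h hh
    have : (0 : ℝ) < h := hh
    positivity
  · have := (hd 0).continuousAt.tendsto.mono_left (nhdsWithin_le_nhds (s := Ioi 0))
    simpa [two_mul] using this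
  · have := (hp 0).continuousAt.tendsto.mono_left (nhdsWithin_le_nhds (s := Ioi 0))
    simpa using this

/-- Reduction of a point to the window `[-1, 1]`. -/
theorem exists_window_rep (x : ℝ) : ∃ y ∈ Icc (-1 : ℝ) 1, ∀ f : ℝ → ℝ, Function.Periodic f 2 →
    ∀ z, f (x + z) = f (y + z) := by
  refine ⟨x - (toIcoDiv (two_pos : (0 : ℝ) < 2) (-1) x) • (2 : ℝ), ?_, fun f hf z => ?_⟩
  · have := sub_toIcoDiv_zsmul_mem_Ico (two_pos : (0 : ℝ) < 2) (-1) x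
    exact ⟨this.1, by linarith [this.2]⟩
  · rw [show x - (toIcoDiv (two_pos : (0 : ℝ) < 2) (-1) x) • (2 : ℝ) + z
      = x + z - (toIcoDiv (two_pos : (0 : ℝ) < 2) (-1) x) • (2 : ℝ) by ring, hf.sub_zsmul_eq]

theorem exists_bound_of_periodic {w : ℝ → ℝ → ℝ} {s t : ℝ} (hw : Continuous (Function.uncurry w))
    (hp : ∀ τ ∈ Icc s t, Function.Periodic (w τ) 2) :
    ∃ B, 0 < B ∧ ∀ τ ∈ Icc s t, ∀ x, |w τ x| ≤ B := by
  have hK : IsCompact (Icc s t ×ˢ Icc (-1 : ℝ) 1) := isCompact_Icc.prod isCompact_Icc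
  obtain ⟨C, hC⟩ := hK.exists_bound_of_continuousOn hw.continuousOn
  refine ⟨max C 1, by positivity, fun τ hτ x => ?_⟩
  obtain ⟨y, hy, hxy⟩ := exists_window_rep x
  have h1 := hxy (w τ) (hp τ hτ) 0
  simp only [add_zero] at h1
  rw [h1]
  exact (hC (τ, y) ⟨hτ, hy⟩).trans (le_max_left _ _)

theorem exists_modulus_of_periodic {w : ℝ → ℝ → ℝ} {s t η : ℝ}
    (hw : Continuous (Function.uncurry w)) (hη : 0 < η)
    (hp : ∀ τ ∈ Icc s t, Function.Periodic (w τ) 2) :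
    ∃ δ, 0 < δ ∧ ∀ τ ∈ Icc s t, ∀ x z, |z| ≤ δ → |w τ (x + z) - w τ x| ≤ η := by
  have hK : IsCompact (Icc s t ×ˢ Icc (-2 : ℝ) 2) := isCompact_Icc.prod isCompact_Icc
  obtain ⟨δ, hδ, h⟩ := Metric.uniformContinuousOn_iff.1
    (hK.uniformContinuousOn_of_continuous hw.continuousOn) η hη
  refine ⟨min (δ / 2) 1, by positivity, fun τ hτ x z hz => ?_⟩
  have hz1 : |z| ≤ δ / 2 := hz.trans (min_le_left _ _)
  have hz2 := abs_le.1 (hz.trans (min_le_right _ _))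
  obtain ⟨y, hy, hxy⟩ := exists_window_rep x
  have h1 := hxy (w τ) (hp τ hτ) z
  have h0 := hxy (w τ) (hp τ hτ) 0
  simp only [add_zero] at h0
  rw [h1, h0]
  have := h (τ, y + z) ⟨hτ, by linarith [hy.1], by linarith [hy.2]⟩ (τ, y)
    ⟨hτ, by linarith [hy.1], by linarith [hy.2]⟩ ?_
  · exact this.le
  · rw [Prod.dist_eq, dist_self, Real.dist_eq]
    simp only [add_sub_cancel_left]
    rw [max_eq_right (abs_nonneg _)]
    linarith

theorem integral_shift_mul {f g : ℝ → ℝ} (hf : Function.Periodic f 2) (hg : Function.Periodic g 2)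
    (h : ℝ) : ∫ x in (-1 : ℝ)..1, f (x + h) * g x = ∫ x in (-1 : ℝ)..1, f x * g (x - h) := by
  have hp : Function.Periodic (fun x => f x * g (x - h)) 2 := fun x => by
    simp only [hf x]; rw [show x + 2 - h = x - h + 2 by ring, hg]
  have h1 := hp.intervalIntegral_add_eq (-1 + h) (-1)
  rw [show -1 + h + 2 = 1 + h by ring, show (-1 : ℝ) + 2 = 1 by norm_num] at h1
  rw [← h1, ← intervalIntegral.integral_comp_add_right]
  simp
end

section
open Set Filter Topology intervalIntegral

/-- The sup-convolution of `f` with the parabola `z² / (2ε)` over the window `[-1, 1]`. -/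
noncomputable def supConv (ε : ℝ) (f : ℝ → ℝ) (x : ℝ) : ℝ :=
  sSup ((fun z => f (x + z) - z ^ 2 / (2 * ε)) '' Icc (-1) 1)

theorem supConv_ge {ε : ℝ} {f : ℝ → ℝ} (hf : Continuous f) (x : ℝ) {z : ℝ}
    (hz : z ∈ Icc (-1 : ℝ) 1) : f (x + z) - z ^ 2 / (2 * ε) ≤ supConv ε f x := by
  refine le_csSup ?_ (mem_image_of_mem _ hz)
  exact (isCompact_Icc.image (by fun_prop)).bddAbove

theorem le_supConv {ε : ℝ} {f : ℝ → ℝ} (hf : Continuous f) (x : ℝ) : f x ≤ supConv ε f x := by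
  simpa using supConv_ge (ε := ε) hf x (z := 0) (by norm_num)

theorem supConv_continuous {ε : ℝ} {v : ℝ → ℝ → ℝ} (hv : Continuous (Function.uncurry v)) :
    Continuous (Function.uncurry fun t x => supConv ε (v t) x) := by
  have := (isCompact_Icc (a := (-1 : ℝ)) (b := 1)).continuous_sSup
    (f := fun (p : ℝ × ℝ) z => v p.1 (p.2 + z) - z ^ 2 / (2 * ε)) (by fun_prop)
  exact this

theorem supConv_periodic {ε : ℝ} {f : ℝ → ℝ} (hf : Function.Periodic f 2) :
    Function.Periodic (supConv ε f) 2 := by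
  intro x
  simp only [supConv]
  congr 1
  ext w
  simp only [mem_image]
  refine exists_congr fun z => ?_
  rw [show x + 2 + z = x + z + 2 by ring, hf]

/-- The supremum is attained close to the base point. -/
theorem exists_supConv_eq {ε B δ : ℝ} {f : ℝ → ℝ} (hf : Continuous f) (hε : 0 < ε)
    (hB : ∀ x, |f x| ≤ B) (hδ : 0 ≤ δ) (hεδ : 4 * B * ε ≤ δ ^ 2) (x : ℝ) :
    ∃ z, |z| ≤ δ ∧ supConv ε f x = f (x + z) - z ^ 2 / (2 * ε) := by
  have hne : (Icc (-1 : ℝ) 1).Nonempty := ⟨0, by norm_num⟩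
  obtain ⟨z, -, hz⟩ := isCompact_Icc.exists_sSup_image_eq
    (f := fun z => f (x + z) - z ^ 2 / (2 * ε))
    hne (by fun_prop)
  refine ⟨z, ?_, hz⟩
  have h1 : f x ≤ f (x + z) - z ^ 2 / (2 * ε) := hz ▸ le_supConv hf x
  have h2 := abs_le.1 (hB x)
  have h3 := abs_le.1 (hB (x + z))
  have h4 : z ^ 2 / (2 * ε) ≤ 2 * B := by linarith
  rw [div_le_iff₀ (by positivity)] at h4
  exact abs_le_of_sq_le_sq (by nlinarith) hδ

section Pointwise

variable {ε δ η x z : ℝ} {f f1 : ℝ → ℝ}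

theorem supConv_shift_ge_of_eq (hf : Continuous f) (hε : 0 < ε)
    (hz : supConv ε f x = f (x + z) - z ^ 2 / (2 * ε)) {h : ℝ} (hzh : z - h ∈ Icc (-1 : ℝ) 1) :
    z * h / ε - h ^ 2 / (2 * ε) ≤ supConv ε f (x + h) - supConv ε f x := by
  have := supConv_ge (ε := ε) hf (x + h) hzh
  rw [show x + h + (z - h) = x + z by ring] at this
  rw [hz]
  have e : (z - h) ^ 2 / (2 * ε) = z ^ 2 / (2 * ε) - z * h / ε + h ^ 2 / (2 * ε) := by
    field_simp; ring
  linarith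

theorem diff_le_supConv_diff (hf : Continuous f)
    (hz : supConv ε f x = f (x + z) - z ^ 2 / (2 * ε)) (hz1 : z ∈ Icc (-1 : ℝ) 1) (h : ℝ) :
    f (x + z + h) - f (x + z) ≤ supConv ε f (x + h) - supConv ε f x := by
  have := supConv_ge (ε := ε) hf (x + h) hz1
  rw [show x + h + z = x + z + h by ring] at this
  rw [hz]; linarith

theorem diff_le_of_supConv_eq (hf : Continuous f) (hε : 0 < ε)
    (hz : supConv ε f x = f (x + z) - z ^ 2 / (2 * ε)) {h : ℝ} (hzh : z + h ∈ Icc (-1 : ℝ) 1) :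
    f (x + z + h) - f (x + z) ≤ z * h / ε + h ^ 2 / (2 * ε) := by
  have := supConv_ge (ε := ε) hf x hzh
  rw [← add_assoc, hz] at this
  have e : (z + h) ^ 2 / (2 * ε) = z ^ 2 / (2 * ε) + z * h / ε + h ^ 2 / (2 * ε) := by
    field_simp; ring
  linarith

theorem deriv_eq_of_supConv_eq (hε : 0 < ε) (hf1 : ∀ x, HasDerivAt f (f1 x) x)
    (hz : supConv ε f x = f (x + z) - z ^ 2 / (2 * ε)) (hzδ : |z| ≤ 1 / 2) :
    f1 (x + z) = z / ε := by
  have hf : Continuous f := continuous_iff_continuousAt.2 fun x => (hf1 x).continuousAt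
  have hz' := abs_le.1 hzδ
  have hmax : IsLocalMax (fun w => f (x + w) - w ^ 2 / (2 * ε)) z := by
    have : Icc (-1 : ℝ) 1 ∈ 𝓝 z := Icc_mem_nhds (by linarith) (by linarith)
    filter_upwards [this] with w hw
    rw [← hz]; exact supConv_ge hf x hw
  have hd : HasDerivAt (fun w => f (x + w) - w ^ 2 / (2 * ε)) (f1 (x + z) - z / ε) z := by
    refine (((hf1 (x + z)).comp_const_add x z).sub
      ((hasDerivAt_pow 2 z).div_const (2 * ε))).congr_deriv ?_
    field_simp
    ring
  have := hmax.hasDerivAt_eq_zero hd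
  linarith

theorem second_deriv_le_of_supConv_eq {f2 : ℝ} (hε : 0 < ε) (hf1 : ∀ x, HasDerivAt f (f1 x) x)
    (hf2 : HasDerivAt f1 f2 (x + z))
    (hz : supConv ε f x = f (x + z) - z ^ 2 / (2 * ε)) (hzδ : |z| ≤ 1 / 2) :
    f2 ≤ 1 / ε := by
  have hf : Continuous f := continuous_iff_continuousAt.2 fun x => (hf1 x).continuousAt
  have hz' := abs_le.1 hzδ
  refine le_of_tendsto (tendsto_second_difference hf1 hf2) ?_
  filter_upwards [Ioo_mem_nhdsGT (show (0 : ℝ) < 1 / 2 by norm_num)] with h hh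
  have h1 := diff_le_of_supConv_eq hf hε hz (h := h)
    ⟨by linarith [hh.1], by linarith [hh.2]⟩
  have h2 := diff_le_of_supConv_eq hf hε hz (h := -h)
    ⟨by linarith [hh.2], by linarith [hh.1]⟩
  rw [← sub_eq_add_neg] at h2
  rw [div_le_iff₀ (pow_pos hh.1 2)]
  have e : 1 / ε * h ^ 2 = (z * h / ε + h ^ 2 / (2 * ε)) + (z * (-h) / ε + (-h) ^ 2 / (2 * ε)) := by
    field_simp; ring
  rw [e]; linarith

end Pointwise

/-- The centred discretization of `α ∂ₓ + H ∂ₓ²` with step `h`. -/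
noncomputable def discreteOp (α H h : ℝ) (f : ℝ → ℝ) (x : ℝ) : ℝ :=
  α * ((f (x + h) - f (x - h)) / (2 * h)) + H * ((f (x + h) + f (x - h) - 2 * f x) / h ^ 2)

theorem discreteOp_eq {α H h : ℝ} (hh : 0 < h) (f : ℝ → ℝ) (x : ℝ) :
    discreteOp α H h f x = (H / h ^ 2 + α / (2 * h)) * (f (x + h) - f x) +
      (H / h ^ 2 - α / (2 * h)) * (f (x + -h) - f x) := by
  rw [← sub_eq_add_neg]
  simp only [discreteOp]; field_simp; ring

theorem discreteOp_coeff_nonneg {α H h : ℝ} (hh : 0 < h) (hα : |α| * h ≤ 2 * H) :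
    0 ≤ H / h ^ 2 + α / (2 * h) ∧ 0 ≤ H / h ^ 2 - α / (2 * h) := by
  have h1 := neg_abs_le α
  have h2 := le_abs_self α
  have e1 : H / h ^ 2 + α / (2 * h) = (2 * H + α * h) / (2 * h ^ 2) := by field_simp
  have e2 : H / h ^ 2 - α / (2 * h) = (2 * H - α * h) / (2 * h ^ 2) := by field_simp
  rw [e1, e2]
  constructor <;> refine div_nonneg ?_ (by positivity) <;> nlinarith

theorem discreteOp_le_supConv {ε α H h x z : ℝ} {f : ℝ → ℝ} (hf : Continuous f) (hh : 0 < h)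
    (hα : |α| * h ≤ 2 * H) (hz : supConv ε f x = f (x + z) - z ^ 2 / (2 * ε))
    (hz1 : z ∈ Icc (-1 : ℝ) 1) :
    discreteOp α H h f (x + z) ≤ discreteOp α H h (supConv ε f) x := by
  rw [discreteOp_eq hh, discreteOp_eq hh]
  obtain ⟨hp, hq⟩ := discreteOp_coeff_nonneg hh hα
  exact add_le_add (mul_le_mul_of_nonneg_left (diff_le_supConv_diff hf hz hz1 h) hp)
    (mul_le_mul_of_nonneg_left (diff_le_supConv_diff hf hz hz1 (-h)) hq)

theorem neg_le_discreteOp_supConv {ε α H h x z A : ℝ} {f : ℝ → ℝ} (hf : Continuous f)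
    (hε : 0 < ε) (hh : 0 < h) (hh1 : h < 1 / 2) (hα : |α| * h ≤ 2 * H) (hA : |α| ≤ A)
    (hz : supConv ε f x = f (x + z) - z ^ 2 / (2 * ε)) (hz1 : |z| ≤ 1 / 2) :
    -((A + H) / ε) ≤ discreteOp α H h (supConv ε f) x := by
  rw [discreteOp_eq hh]
  obtain ⟨hp, hq⟩ := discreteOp_coeff_nonneg hh hα
  have hz' := abs_le.1 hz1
  have h1 := mul_le_mul_of_nonneg_left (supConv_shift_ge_of_eq hf hε hz (h := h)
    ⟨by linarith, by linarith⟩) hp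
  have h2 := mul_le_mul_of_nonneg_left (supConv_shift_ge_of_eq hf hε hz (h := -h)
    ⟨by linarith, by linarith⟩) hq
  have e : (H / h ^ 2 + α / (2 * h)) * (z * h / ε - h ^ 2 / (2 * ε)) +
      (H / h ^ 2 - α / (2 * h)) * (z * -h / ε - (-h) ^ 2 / (2 * ε)) = (α * z - H) / ε := by
    field_simp; ring
  have h3 : -(A + H) ≤ α * z - H := by
    have : |α * z| ≤ A := by
      rw [abs_mul]
      nlinarith [abs_nonneg α, abs_nonneg z]
    linarith [neg_abs_le (α * z)]
  have h4 := div_le_div_of_nonneg_right h3 hε.le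
  rw [neg_div] at h4
  linarith

theorem discreteOp_tendsto {α H y f2 : ℝ} {f f1 : ℝ → ℝ} (hf1 : ∀ x, HasDerivAt f (f1 x) x)
    (hf2 : HasDerivAt f1 f2 y) :
    Tendsto (fun h => discreteOp α H h f y) (𝓝[>] 0) (𝓝 (α * f1 y + H * f2)) :=
  ((tendsto_central_difference (hf1 y)).const_mul α).add
    ((tendsto_second_difference hf1 hf2).const_mul H)

end

section
open Set Filter Topology intervalIntegral

/-- `v` is a pointwise solution of `∂ₜ v = a ∂ₓ v + b v + H ∂ₓ² v` for positive times, 2-periodic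
in space, where `b = ∂ₓ a`; `v₁` and `v₂` are the first two space derivatives of `v`. -/
structure IsLinearSolution (H : ℝ) (a b v v₁ v₂ : ℝ → ℝ → ℝ) : Prop where
  continuous_a : Continuous (Function.uncurry a)
  continuous_b : Continuous (Function.uncurry b)
  continuous_v : Continuous (Function.uncurry v)
  periodic_a : ∀ t, 0 < t → Function.Periodic (a t) 2
  periodic_b : ∀ t, 0 < t → Function.Periodic (b t) 2
  periodic_v : ∀ t, 0 < t → Function.Periodic (v t) 2
  hasDerivAt_a : ∀ t, 0 < t → ∀ x, HasDerivAt (a t) (b t x) x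
  hasDerivAt_v : ∀ t, 0 < t → ∀ x, HasDerivAt (v t) (v₁ t x) x
  hasDerivAt_v₁ : ∀ t, 0 < t → ∀ x, HasDerivAt (v₁ t) (v₂ t x) x
  hasDerivAt_time : ∀ t, 0 < t → ∀ x,
    HasDerivAt (fun s => v s x) (a t x * v₁ t x + b t x * v t x + H * v₂ t x) t

theorem tendsto_left_quotient {f : ℝ → ℝ} {f' τ : ℝ} (hf : HasDerivAt f f' τ) :
    Tendsto (fun k => (f τ - f (τ - k)) / k) (𝓝[>] 0) (𝓝 f') := by
  have h1 : HasDerivAt (fun k => f τ - f (τ - k)) f' 0 := by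
    have hb : HasDerivAt (fun k => f (τ - k)) (-f') 0 := by
      simpa using HasDerivAt.comp_const_sub τ 0 (by simpa using hf)
    simpa using hb.const_sub (f τ)
  refine h1.tendsto_slope_zero_right.congr' ?_
  filter_upwards [self_mem_nhdsWithin] with h hh
  simp only [zero_add, sub_zero, sub_self, smul_eq_mul]
  field_simp

/-- Bounds for a linear solution and its coefficients on `[s, t]`, together with a scale `ε`
at which the sup-convolution only looks at distance `δ`, where `v` and `b` oscillate by at
most `η`. -/
structure SupConvControl (a b v : ℝ → ℝ → ℝ) (s t A L B η δ ε : ℝ) : Prop where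
  pos : 0 < s
  ε_pos : 0 < ε
  δ_nonneg : 0 ≤ δ
  δ_le : δ ≤ 1 / 2
  scale : 4 * B * ε ≤ δ ^ 2
  bound_a : ∀ τ ∈ Icc s t, ∀ x, |a τ x| ≤ A
  bound_b : ∀ τ ∈ Icc s t, ∀ x, |b τ x| ≤ L
  bound_v : ∀ τ ∈ Icc s t, ∀ x, |v τ x| ≤ B
  modulus_b : ∀ τ ∈ Icc s t, ∀ x z, |z| ≤ δ → |b τ (x + z) - b τ x| ≤ η
  modulus_v : ∀ τ ∈ Icc s t, ∀ x z, |z| ≤ δ → |v τ (x + z) - v τ x| ≤ η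

variable {H s t A L B η δ ε : ℝ} {a b v v₁ v₂ : ℝ → ℝ → ℝ}

namespace IsLinearSolution

theorem continuous_slice (hs : IsLinearSolution H a b v v₁ v₂) (τ : ℝ) : Continuous (v τ) :=
  hs.continuous_v.comp (Continuous.prodMk_right τ)

theorem exists_max (hs : IsLinearSolution H a b v v₁ v₂) (hc : SupConvControl a b v s t A L B η δ ε)
    {τ : ℝ} (hτ : τ ∈ Icc s t) (x : ℝ) :
    ∃ z, |z| ≤ δ ∧ supConv ε (v τ) x = v τ (x + z) - z ^ 2 / (2 * ε) :=
  exists_supConv_eq (hs.continuous_slice τ) hc.ε_pos (hc.bound_v τ hτ) hc.δ_nonneg hc.scale x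

theorem supConv_le (hs : IsLinearSolution H a b v v₁ v₂)
    (hc : SupConvControl a b v s t A L B η δ ε) {τ : ℝ} (hτ : τ ∈ Icc s t) (x : ℝ) :
    supConv ε (v τ) x ≤ v τ x + η := by
  obtain ⟨z, hz, hz2⟩ := hs.exists_max hc hτ x
  have h1 := (abs_le.1 (hc.modulus_v τ hτ x z hz)).2
  have h2 : 0 ≤ z ^ 2 / (2 * ε) := div_nonneg (sq_nonneg _) (by linarith [hc.ε_pos])
  rw [hz2]; linarith

theorem time_deriv_le (hH : 0 < H) (hs : IsLinearSolution H a b v v₁ v₂)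
    (hc : SupConvControl a b v s t A L B η δ ε) {τ x z : ℝ} (hτ : τ ∈ Icc s t) (hz : |z| ≤ δ)
    (hz2 : supConv ε (v τ) x = v τ (x + z) - z ^ 2 / (2 * ε)) :
    a τ (x + z) * v₁ τ (x + z) + b τ (x + z) * v τ (x + z) + H * v₂ τ (x + z)
      ≤ (A + H) / ε + L * B := by
  have hτ0 : 0 < τ := hc.pos.trans_le hτ.1
  have hz' : |z| ≤ 1 / 2 := hz.trans hc.δ_le
  have hε := hc.ε_pos
  rw [deriv_eq_of_supConv_eq hε (hs.hasDerivAt_v τ hτ0) hz2 hz']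
  have h2 := second_deriv_le_of_supConv_eq hε (hs.hasDerivAt_v τ hτ0)
    (hs.hasDerivAt_v₁ τ hτ0 (x + z)) hz2 hz'
  have ha := hc.bound_a τ hτ (x + z)
  have h3 : a τ (x + z) * (z / ε) ≤ A / ε := by
    rw [mul_div_assoc']
    refine div_le_div_of_nonneg_right ((le_abs_self _).trans ?_) hε.le
    rw [abs_mul]
    nlinarith [abs_nonneg z, abs_nonneg (a τ (x + z))]
  have h4 : b τ (x + z) * v τ (x + z) ≤ L * B := by
    refine (le_abs_self _).trans ?_
    rw [abs_mul]
    exact mul_le_mul (hc.bound_b τ hτ _) (hc.bound_v τ hτ _) (abs_nonneg _)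
      ((abs_nonneg _).trans (hc.bound_b τ hτ 0))
  have h5 : H * v₂ τ (x + z) ≤ H / ε := by
    have := mul_le_mul_of_nonneg_left h2 hH.le
    rwa [mul_one_div] at this
  rw [add_div]; linarith

theorem time_deriv_le_frozen (hs : IsLinearSolution H a b v v₁ v₂)
    (hc : SupConvControl a b v s t A L B η δ ε) {τ x z : ℝ} (hτ : τ ∈ Icc s t) (hz : |z| ≤ δ)
    (hz2 : supConv ε (v τ) x = v τ (x + z) - z ^ 2 / (2 * ε)) :
    a τ (x + z) * v₁ τ (x + z) + b τ (x + z) * v τ (x + z) + H * v₂ τ (x + z)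
      ≤ (a τ x * v₁ τ (x + z) + H * v₂ τ (x + z)) + b τ x * supConv ε (v τ) x
        + (3 * L + B) * η := by
  have hτ0 : 0 < τ := hc.pos.trans_le hτ.1
  have hz' : |z| ≤ 1 / 2 := hz.trans hc.δ_le
  have hε := hc.ε_pos
  rw [deriv_eq_of_supConv_eq hε (hs.hasDerivAt_v τ hτ0) hz2 hz']
  have hlip : |a τ (x + z) - a τ x| ≤ L * |z| := by
    have := convex_univ.norm_image_sub_le_of_norm_hasDerivWithin_le (f := a τ) (f' := b τ) (C := L)
      (fun y _ => (hs.hasDerivAt_a τ hτ0 y).hasDerivWithinAt) (fun y _ => hc.bound_b τ hτ y)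
      (mem_univ x) (mem_univ (x + z))
    simpa using this
  have hL : 0 ≤ L := (abs_nonneg _).trans (hc.bound_b τ hτ 0)
  have h0 := le_supConv (ε := ε) (hs.continuous_slice τ) x
  have hη := hc.modulus_v τ hτ x z hz
  have hsq : z ^ 2 / (2 * ε) ≤ η := by linarith [(abs_le.1 hη).2]
  have hsq0 : 0 ≤ z ^ 2 / (2 * ε) := by positivity
  have h1 : (a τ (x + z) - a τ x) * (z / ε) ≤ 2 * L * η := by
    refine (le_abs_self _).trans ?_
    rw [abs_mul, abs_div, abs_of_pos hε]
    calc _ ≤ L * |z| * (|z| / ε) := mul_le_mul_of_nonneg_right hlip (by positivity)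
      _ = 2 * L * (z ^ 2 / (2 * ε)) := by rw [← sq_abs z]; field_simp
      _ ≤ _ := mul_le_mul_of_nonneg_left hsq (by linarith)
  have h2 : (b τ (x + z) - b τ x) * v τ (x + z) ≤ η * B := by
    refine (le_abs_self _).trans ?_
    rw [abs_mul]
    have h := hc.modulus_b τ hτ x z hz
    exact mul_le_mul h (hc.bound_v τ hτ _) (abs_nonneg _) ((abs_nonneg _).trans h)
  have h3 : b τ x * (z ^ 2 / (2 * ε)) ≤ L * η := by
    refine (le_abs_self _).trans ?_
    rw [abs_mul, abs_of_nonneg hsq0]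
    exact mul_le_mul (hc.bound_b τ hτ _) hsq hsq0 hL
  rw [hz2]
  linarith

theorem supConv_sub_le (hs : IsLinearSolution H a b v v₁ v₂)
    (hc : SupConvControl a b v s t A L B η δ ε) {τ x z : ℝ} (hz : |z| ≤ δ)
    (hz2 : supConv ε (v τ) x = v τ (x + z) - z ^ 2 / (2 * ε)) (τ' : ℝ) :
    supConv ε (v τ) x - supConv ε (v τ') x ≤ v τ (x + z) - v τ' (x + z) := by
  have hz' := abs_le.1 (hz.trans hc.δ_le)
  have := supConv_ge (ε := ε) (hs.continuous_slice τ') x (z := z) ⟨by linarith, by linarith⟩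
  rw [hz2]; linarith

theorem supConv_time_le (hH : 0 < H) (hs : IsLinearSolution H a b v v₁ v₂)
    (hc : SupConvControl a b v s t A L B η δ ε) {τ τ' : ℝ} (x : ℝ) (hτ' : s ≤ τ') (h : τ' ≤ τ)
    (hτ : τ ≤ t) :
    supConv ε (v τ) x - supConv ε (v τ') x ≤ ((A + H) / ε + L * B) * (τ - τ') := by
  have hcont : Continuous (fun τ => supConv ε (v τ) x) :=
    (supConv_continuous hs.continuous_v).comp (Continuous.prodMk_left x)
  have := sub_le_integral_of_left_dini h hcont
    (g := fun _ => (A + H) / ε + L * B) continuous_const ?_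
  · rwa [intervalIntegral.integral_const, smul_eq_mul, mul_comm] at this
  · intro r hr q hq
    have hrI : r ∈ Icc s t := ⟨hτ'.trans hr.1.le, hr.2.trans hτ⟩
    obtain ⟨z, hz, hz2⟩ := hs.exists_max hc hrI x
    have hlim := tendsto_left_quotient (hs.hasDerivAt_time r (hc.pos.trans_le hrI.1) (x + z))
    have hlt := (hs.time_deriv_le hH hc hrI hz hz2).trans_lt hq
    refine Eventually.frequently ?_
    filter_upwards [hlim.eventually_lt_const hlt, self_mem_nhdsWithin] with k hk hk0
    refine lt_of_le_of_lt (div_le_div_of_nonneg_right (hs.supConv_sub_le hc hz hz2 (r - k)) ?_) hk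
    exact le_of_lt hk0

/-- The defect of the sup-convolution with respect to the discretized equation. -/
noncomputable def defect (H ε e : ℝ) (a b v : ℝ → ℝ → ℝ) (τ h x : ℝ) : ℝ :=
  (supConv ε (v τ) x - supConv ε (v (τ - h)) x) / h
    - discreteOp (a τ x) H h (supConv ε (v τ)) x - b τ x * supConv ε (v τ) x - e

theorem eventually_small_step (hH : 0 < H) (hA : 0 ≤ A) {τ : ℝ} (hτ : τ ∈ Ioc s t) :
    ∀ᶠ h in 𝓝[>] (0 : ℝ), 0 < h ∧ h < 1 / 2 ∧ A * h ≤ 2 * H ∧ s ≤ τ - h := by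
  have h1 : (0 : ℝ) < min (1 / 2) (min (2 * H / (A + 1)) (τ - s)) := by
    have : 0 < τ - s := by linarith [hτ.1]
    positivity
  filter_upwards [Ioo_mem_nhdsGT h1] with h hh
  have h2 := lt_min_iff.1 hh.2
  have h3 := lt_min_iff.1 h2.2
  refine ⟨hh.1, h2.1, ?_, by linarith⟩
  have := (lt_div_iff₀ (by linarith : (0 : ℝ) < A + 1)).1 h3.1
  nlinarith [hh.1]

theorem defect_tendsto (hH : 0 < H) (hA : 0 ≤ A) (hs : IsLinearSolution H a b v v₁ v₂)
    (hc : SupConvControl a b v s t A L B η δ ε) {τ : ℝ} (hτ : τ ∈ Ioc s t) (x : ℝ) :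
    Tendsto (fun h => max (defect H ε ((3 * L + B) * η) a b v τ h x) 0) (𝓝[>] 0) (𝓝 0) := by
  have hτI : τ ∈ Icc s t := ⟨hτ.1.le, hτ.2⟩
  have hτ0 : 0 < τ := hc.pos.trans hτ.1
  obtain ⟨z, hz, hz2⟩ := hs.exists_max hc hτI x
  have hz' := abs_le.1 (hz.trans hc.δ_le)
  have hlim := ((((tendsto_left_quotient (hs.hasDerivAt_time τ hτ0 (x + z))).sub
    (discreteOp_tendsto (α := a τ x) (H := H) (hs.hasDerivAt_v τ hτ0)
      (hs.hasDerivAt_v₁ τ hτ0 (x + z)))).sub_const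
    (b τ x * supConv ε (v τ) x)).sub_const ((3 * L + B) * η)).max
    (tendsto_const_nhds (x := (0 : ℝ)))
  rw [max_eq_right (by linarith [hs.time_deriv_le_frozen hc hτI hz hz2])] at hlim
  refine tendsto_of_tendsto_of_tendsto_of_le_of_le' tendsto_const_nhds hlim
    (Eventually.of_forall fun h => le_max_right _ _) ?_
  filter_upwards [eventually_small_step hH hA hτ] with h hh
  obtain ⟨h0, h1, h2, h3⟩ := hh
  refine max_le_max ?_ le_rfl
  have hα : |a τ x| * h ≤ 2 * H :=
    (mul_le_mul_of_nonneg_right (hc.bound_a τ hτI x) h0.le).trans h2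
  have e1 := div_le_div_of_nonneg_right (hs.supConv_sub_le hc hz hz2 (τ - h)) h0.le
  have e2 := discreteOp_le_supConv (hs.continuous_slice τ) h0 hα hz2 ⟨by linarith, by linarith⟩
  simp only [defect]
  linarith

theorem defect_le (hH : 0 < H) (hs : IsLinearSolution H a b v v₁ v₂)
    (hc : SupConvControl a b v s t A L B η δ ε) (hη : 0 ≤ η) {τ h : ℝ} (hτ : τ ∈ Ioc s t)
    (h0 : 0 < h) (h1 : h < 1 / 2) (h2 : A * h ≤ 2 * H) (h3 : s ≤ τ - h) (x : ℝ) :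
    defect H ε ((3 * L + B) * η) a b v τ h x ≤ 2 * ((A + H) / ε) + L * B + L * (B + η) := by
  have hτI : τ ∈ Icc s t := ⟨hτ.1.le, hτ.2⟩
  obtain ⟨z, hz, hz2⟩ := hs.exists_max hc hτI x
  have hα : |a τ x| * h ≤ 2 * H :=
    (mul_le_mul_of_nonneg_right (hc.bound_a τ hτI x) h0.le).trans h2
  have e1 := hs.supConv_time_le hH hc x h3 (by linarith) hτ.2
  rw [show τ - (τ - h) = h by ring, ← div_le_iff₀ h0] at e1
  have e2 := neg_le_discreteOp_supConv (hs.continuous_slice τ) hc.ε_pos h0 h1 hα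
    (hc.bound_a τ hτI x) hz2 (hz.trans hc.δ_le)
  have hL : 0 ≤ L := (abs_nonneg _).trans (hc.bound_b τ hτI 0)
  have hB : 0 ≤ B := (abs_nonneg _).trans (hc.bound_v τ hτI 0)
  have e3 : -(L * (B + η)) ≤ b τ x * supConv ε (v τ) x := by
    have hS : |supConv ε (v τ) x| ≤ B + η := by
      have k1 := le_supConv (ε := ε) (hs.continuous_slice τ) x
      have k2 := hs.supConv_le hc hτI x
      have k3 := abs_le.1 (hc.bound_v τ hτI x)
      rw [abs_le]; constructor <;> linarith
    have := mul_le_mul (hc.bound_b τ hτI x) hS (abs_nonneg _) hL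
    rw [← abs_mul] at this
    linarith [neg_abs_le (b τ x * supConv ε (v τ) x)]
  have e4 : 0 ≤ (3 * L + B) * η := by positivity
  simp only [defect]
  linarith

end IsLinearSolution
end

section
open Set Filter Topology intervalIntegral

/-- A 2-periodic `C²` test function with its first two derivatives. -/
structure IsTestFunction (φ φ₁ φ₂ : ℝ → ℝ) : Prop where
  periodic : Function.Periodic φ 2
  hasDerivAt : ∀ x, HasDerivAt φ (φ₁ x) x
  hasDerivAt₁ : ∀ x, HasDerivAt φ₁ (φ₂ x) x
  continuous₂ : Continuous φ₂

theorem Function.Periodic.of_hasDerivAt {f f' : ℝ → ℝ} {c : ℝ} (hf : Function.Periodic f c)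
    (hd : ∀ x, HasDerivAt f (f' x) x) : Function.Periodic f' c := by
  intro x
  have h1 : HasDerivAt f (f' (x + c)) x := by
    have := (hd (x + c)).comp_add_const x c
    rwa [show (fun x => f (x + c)) = f from funext hf] at this
  exact h1.unique (hd x)

theorem exists_bound_of_continuous_periodic {f : ℝ → ℝ} (hf : Continuous f)
    (hp : Function.Periodic f 2) : ∃ B, 0 < B ∧ ∀ x, |f x| ≤ B := by
  obtain ⟨B, hB, h⟩ := exists_bound_of_periodic (w := fun _ => f) (s := 0) (t := 0)
    (by fun_prop) (fun _ _ => hp)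
  exact ⟨B, hB, h 0 (by simp)⟩

namespace IsTestFunction

variable {φ φ₁ φ₂ : ℝ → ℝ}

theorem continuous (h : IsTestFunction φ φ₁ φ₂) : Continuous φ :=
  continuous_iff_continuousAt.2 fun x => (h.hasDerivAt x).continuousAt

theorem continuous₁ (h : IsTestFunction φ φ₁ φ₂) : Continuous φ₁ :=
  continuous_iff_continuousAt.2 fun x => (h.hasDerivAt₁ x).continuousAt

theorem periodic₁ (h : IsTestFunction φ φ₁ φ₂) : Function.Periodic φ₁ 2 :=
  h.periodic.of_hasDerivAt h.hasDerivAt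

theorem periodic₂ (h : IsTestFunction φ φ₁ φ₂) : Function.Periodic φ₂ 2 :=
  h.periodic₁.of_hasDerivAt h.hasDerivAt₁

end IsTestFunction

theorem abs_sub_le_of_abs_deriv_le {f f' : ℝ → ℝ} {K : ℝ} (hd : ∀ x, HasDerivAt f (f' x) x)
    (hK : ∀ x, |f' x| ≤ K) (x y : ℝ) : |f y - f x| ≤ K * |y - x| := by
  simpa using convex_univ.norm_image_sub_le_of_norm_hasDerivWithin_le (f := f) (f' := f') (C := K)
    (fun y _ => (hd y).hasDerivWithinAt) (fun y _ => hK y) (mem_univ x) (mem_univ y)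

theorem abs_second_difference_le {f f₁ f₂ : ℝ → ℝ} {K h : ℝ} (hh : 0 < h)
    (hd : ∀ x, HasDerivAt f (f₁ x) x) (hd₁ : ∀ x, HasDerivAt f₁ (f₂ x) x)
    (hK : ∀ x, |f₂ x| ≤ K) (x : ℝ) : |f (x + h) + f (x - h) - 2 * f x| ≤ K * h ^ 2 := by
  have h1 : ∀ y, HasDerivAt (fun y => f (y + h) - f y) (f₁ (y + h) - f₁ y) y := fun y =>
    ((hd (y + h)).comp_add_const y h).sub (hd y)
  have h2 : ∀ y, |f₁ (y + h) - f₁ y| ≤ K * h := fun y => by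
    have := abs_sub_le_of_abs_deriv_le hd₁ hK y (y + h)
    rwa [add_sub_cancel_left, abs_of_pos hh] at this
  have h3 := abs_sub_le_of_abs_deriv_le h1 h2 (x - h) x
  simp only [sub_add_cancel, sub_sub_cancel, abs_of_pos hh] at h3
  calc _ = |f (x + h) - f x - (f x - f (x - h))| := by congr 1; ring
    _ ≤ K * h * h := h3
    _ = _ := by ring

theorem integral_combination {f₁ f₂ f₃ f₄ f₅ : ℝ → ℝ} (h₁ : Continuous f₁) (h₂ : Continuous f₂)
    (h₃ : Continuous f₃) (h₄ : Continuous f₄) (h₅ : Continuous f₅) (c d p q : ℝ) :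
    ∫ x in p..q, (c * (f₁ x - f₂ x) + d * (f₃ x + f₄ x - 2 * f₅ x)) =
      c * ((∫ x in p..q, f₁ x) - ∫ x in p..q, f₂ x) +
        d * ((∫ x in p..q, f₃ x) + (∫ x in p..q, f₄ x) - 2 * ∫ x in p..q, f₅ x) := by
  have i : ∀ {f : ℝ → ℝ}, Continuous f → IntervalIntegrable f volume p q := fun h =>
    h.intervalIntegrable _ _
  rw [intervalIntegral.integral_add (i (by fun_prop)) (i (by fun_prop)),
    intervalIntegral.integral_const_mul, intervalIntegral.integral_const_mul,
    intervalIntegral.integral_sub (i h₁) (i h₂),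
    intervalIntegral.integral_sub (i (by fun_prop)) (i (by fun_prop)),
    intervalIntegral.integral_add (i h₃) (i h₄), intervalIntegral.integral_const_mul]

/-- Discrete integration by parts. -/
theorem integral_discreteOp_mul {S α φ : ℝ → ℝ} (hS : Continuous S) (hα : Continuous α)
    (hφ : Continuous φ) (hSp : Function.Periodic S 2) (hαp : Function.Periodic α 2)
    (hφp : Function.Periodic φ 2) (H h : ℝ) :
    ∫ x in (-1 : ℝ)..1, discreteOp (α x) H h S x * φ x =
      ∫ x in (-1 : ℝ)..1, S x * (H * ((φ (x + h) + φ (x - h) - 2 * φ x) / h ^ 2) -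
        (α (x + h) * φ (x + h) - α (x - h) * φ (x - h)) / (2 * h)) := by
  have hψp : Function.Periodic (fun x => α x * φ x) 2 := hαp.mul hφp
  have j1 := integral_shift_mul hSp hψp h
  have j2 := integral_shift_mul hSp hψp (-h)
  have j3 := integral_shift_mul hSp hφp h
  have j4 := integral_shift_mul hSp hφp (-h)
  simp only [sub_neg_eq_add, ← sub_eq_add_neg] at j1 j2 j3 j4
  have l := integral_combination (f₁ := fun x => S (x + h) * (α x * φ x))
    (f₂ := fun x => S (x - h) * (α x * φ x)) (f₃ := fun x => S (x + h) * φ x)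
    (f₄ := fun x => S (x - h) * φ x) (f₅ := fun x => S x * φ x)
    (by fun_prop) (by fun_prop) (by fun_prop) (by fun_prop) (by fun_prop) (1 / (2 * h)) (H / h ^ 2)
    (-1) 1
  have r := integral_combination (f₁ := fun x => S x * (α (x - h) * φ (x - h)))
    (f₂ := fun x => S x * (α (x + h) * φ (x + h))) (f₃ := fun x => S x * φ (x - h))
    (f₄ := fun x => S x * φ (x + h)) (f₅ := fun x => S x * φ x)
    (by fun_prop) (by fun_prop) (by fun_prop) (by fun_prop) (by fun_prop) (1 / (2 * h)) (H / h ^ 2)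
    (-1) 1
  rw [j1, j2, j3, j4] at l
  refine Eq.trans ?_ ((l.trans r.symm).trans ?_)
  · congr 1; ext x; simp only [discreteOp]; ring
  · congr 1; ext x; ring

variable {H s t A L B η δ ε : ℝ} {a b v v₁ v₂ : ℝ → ℝ → ℝ} {φ φ₁ φ₂ : ℝ → ℝ}

namespace IsLinearSolution

theorem continuous_supConv (hs : IsLinearSolution H a b v v₁ v₂) (τ : ℝ) :
    Continuous (supConv ε (v τ)) :=
  (supConv_continuous hs.continuous_v).comp (Continuous.prodMk_right τ)

theorem tendsto_integral_discreteOp (hs : IsLinearSolution H a b v v₁ v₂)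
    (hφ : IsTestFunction φ φ₁ φ₂) {τ : ℝ} (hτ : 0 < τ) :
    Tendsto (fun h => ∫ x in (-1 : ℝ)..1, discreteOp (a τ x) H h (supConv ε (v τ)) x * φ x)
      (𝓝[>] 0) (𝓝 (∫ x in (-1 : ℝ)..1, supConv ε (v τ) x *
        (H * φ₂ x - (b τ x * φ x + a τ x * φ₁ x)))) := by
  have hS := hs.continuous_supConv (ε := ε) τ
  have hSp := supConv_periodic (ε := ε) (hs.periodic_v τ hτ)
  have ha : Continuous (a τ) := hs.continuous_a.comp (Continuous.prodMk_right τ)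
  have hb : Continuous (b τ) := hs.continuous_b.comp (Continuous.prodMk_right τ)
  have hφc := hφ.continuous
  have hφ₁c := hφ.continuous₁
  simp_rw [integral_discreteOp_mul hS ha hφc hSp (hs.periodic_a τ hτ) hφ.periodic]
  have hψ : ∀ x, HasDerivAt (fun x => a τ x * φ x) (b τ x * φ x + a τ x * φ₁ x) x := fun x =>
    (hs.hasDerivAt_a τ hτ x).mul (hφ.hasDerivAt x)
  obtain ⟨K₀, hK₀, hS₀⟩ := exists_bound_of_continuous_periodic hS hSp
  obtain ⟨K₁, hK₁, hψ₁⟩ := exists_bound_of_continuous_periodic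
    (f := fun x => b τ x * φ x + a τ x * φ₁ x) (by fun_prop)
    (((hs.periodic_b τ hτ).mul hφ.periodic).add ((hs.periodic_a τ hτ).mul hφ.periodic₁))
  obtain ⟨K₂, hK₂, hφ₂⟩ := exists_bound_of_continuous_periodic hφ.continuous₂ hφ.periodic₂
  refine intervalIntegral.tendsto_integral_filter_of_dominated_convergence
    (fun _ => K₀ * (|H| * K₂ + K₁)) ?_ ?_ (by simp) ?_
  · refine Eventually.of_forall fun h => Continuous.aestronglyMeasurable ?_
    fun_prop
  · filter_upwards [self_mem_nhdsWithin] with h hh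
    refine Eventually.of_forall fun x _ => ?_
    have hh0 : 0 < h := hh
    rw [norm_mul]
    refine mul_le_mul (hS₀ x) ((norm_sub_le _ _).trans (add_le_add ?_ ?_)) (norm_nonneg _) hK₀.le
    · rw [norm_mul, Real.norm_eq_abs, Real.norm_eq_abs, abs_div, abs_of_pos (pow_pos hh0 2)]
      refine mul_le_mul_of_nonneg_left ?_ (abs_nonneg _)
      rw [div_le_iff₀ (pow_pos hh0 2)]
      exact abs_second_difference_le hh0 hφ.hasDerivAt hφ.hasDerivAt₁ hφ₂ x
    · rw [Real.norm_eq_abs, abs_div, abs_of_pos (by positivity : 0 < 2 * h),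
        div_le_iff₀ (by positivity)]
      have := abs_sub_le_of_abs_deriv_le hψ hψ₁ (x - h) (x + h)
      rwa [show x + h - (x - h) = 2 * h by ring, abs_of_pos (by positivity : 0 < 2 * h)] at this
  · refine Eventually.of_forall fun x _ => Tendsto.const_mul _ (Tendsto.sub ?_ ?_)
    · exact (tendsto_second_difference hφ.hasDerivAt (hφ.hasDerivAt₁ x)).const_mul H
    · exact tendsto_central_difference (hψ x)

theorem tendsto_integral_defect (hH : 0 < H) (hA : 0 ≤ A) (hη : 0 ≤ η)
    (hs : IsLinearSolution H a b v v₁ v₂)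
    (hc : SupConvControl a b v s t A L B η δ ε) (hφ : Continuous φ) (hφ0 : ∀ x, 0 ≤ φ x)
    {τ : ℝ} (hτ : τ ∈ Ioc s t) :
    Tendsto (fun h => ∫ x in (-1 : ℝ)..1,
      max (defect H ε ((3 * L + B) * η) a b v τ h x) 0 * φ x) (𝓝[>] 0) (𝓝 0) := by
  have ha : Continuous (a τ) := hs.continuous_a.comp (Continuous.prodMk_right τ)
  have hb : Continuous (b τ) := hs.continuous_b.comp (Continuous.prodMk_right τ)
  have hS := fun r => hs.continuous_supConv (ε := ε) r
  suffices key : Tendsto (fun h => ∫ x in (-1 : ℝ)..1,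
      max (defect H ε ((3 * L + B) * η) a b v τ h x) 0 * φ x) (𝓝[>] 0)
      (𝓝 (∫ x in (-1 : ℝ)..1, 0 * φ x)) by simpa using key
  refine intervalIntegral.tendsto_integral_filter_of_dominated_convergence
    (fun x => max (2 * ((A + H) / ε) + L * B + L * (B + η)) 0 * φ x) ?_ ?_
    ((by fun_prop : Continuous _).intervalIntegrable _ _) ?_
  · refine Eventually.of_forall fun h => Continuous.aestronglyMeasurable ?_
    have := hS τ
    have := hS (τ - h)
    simp only [defect, discreteOp]
    fun_prop
  · filter_upwards [eventually_small_step hH hA hτ] with h hh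
    obtain ⟨h1, h2, h3, h4⟩ := hh
    refine Eventually.of_forall fun x _ => ?_
    rw [norm_mul, Real.norm_eq_abs, Real.norm_eq_abs, abs_of_nonneg (hφ0 x),
      abs_of_nonneg (le_max_right _ _)]
    exact mul_le_mul_of_nonneg_right
      (max_le_max (hs.defect_le hH hc hη hτ h1 h2 h3 h4 x) le_rfl) (hφ0 x)
  · exact Eventually.of_forall fun x _ => (hs.defect_tendsto hH hA hc hτ x).mul_const _

theorem supConv_left_dini (hH : 0 < H) (hA : 0 ≤ A) (hη : 0 ≤ η)
    (hs : IsLinearSolution H a b v v₁ v₂)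
    (hc : SupConvControl a b v s t A L B η δ ε) (hφ : IsTestFunction φ φ₁ φ₂)
    (hφ0 : ∀ x, 0 ≤ φ x) {τ : ℝ} (hτ : τ ∈ Ioc s t) {r : ℝ}
    (hr : (∫ x in (-1 : ℝ)..1, supConv ε (v τ) x * (H * φ₂ x - a τ x * φ₁ x)) +
      (3 * L + B) * η * (∫ x in (-1 : ℝ)..1, φ x) < r) :
    ∃ᶠ k in 𝓝[>] (0 : ℝ), ((∫ x in (-1 : ℝ)..1, supConv ε (v τ) x * φ x) -
      ∫ x in (-1 : ℝ)..1, supConv ε (v (τ - k)) x * φ x) / k < r := by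
  have hτ0 : 0 < τ := hc.pos.trans hτ.1
  have ha : Continuous (a τ) := hs.continuous_a.comp (Continuous.prodMk_right τ)
  have hb : Continuous (b τ) := hs.continuous_b.comp (Continuous.prodMk_right τ)
  have hS := fun r => hs.continuous_supConv (ε := ε) r
  have hSτ := hS τ
  have hφc := hφ.continuous
  have hφ₁c := hφ.continuous₁
  have hφ₂c := hφ.continuous₂
  have i : ∀ {f : ℝ → ℝ}, Continuous f → IntervalIntegrable f volume (-1) 1 := fun h =>
    h.intervalIntegrable _ _
  have hlim := (((hs.tendsto_integral_defect hH hA hη hc hφc hφ0 hτ).add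
    (hs.tendsto_integral_discreteOp (ε := ε) hφ hτ0)).add_const
    (∫ x in (-1 : ℝ)..1, b τ x * supConv ε (v τ) x * φ x)).add_const
    ((3 * L + B) * η * (∫ x in (-1 : ℝ)..1, φ x))
  have e : 0 + (∫ x in (-1 : ℝ)..1, supConv ε (v τ) x *
      (H * φ₂ x - (b τ x * φ x + a τ x * φ₁ x))) +
      (∫ x in (-1 : ℝ)..1, b τ x * supConv ε (v τ) x * φ x) =
      ∫ x in (-1 : ℝ)..1, supConv ε (v τ) x * (H * φ₂ x - a τ x * φ₁ x) := by
    rw [zero_add, ← intervalIntegral.integral_add (i (by fun_prop)) (i (by fun_prop))]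
    congr 1; ext x; ring
  rw [e] at hlim
  refine Eventually.frequently ?_
  filter_upwards [hlim.eventually_lt_const hr, self_mem_nhdsWithin] with k hk hk0
  refine lt_of_le_of_lt ?_ hk
  have hSk := hS (τ - k)
  have hD : Continuous (fun x => discreteOp (a τ x) H k (supConv ε (v τ)) x) := by
    simp only [discreteOp]; fun_prop
  have hF : Continuous (fun x => defect H ε ((3 * L + B) * η) a b v τ k x) := by
    simp only [defect]; fun_prop
  rw [← intervalIntegral.integral_const_mul,
    ← intervalIntegral.integral_add (i (by fun_prop)) (i (by fun_prop)),
    ← intervalIntegral.integral_add (i (by fun_prop)) (i (by fun_prop)),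
    ← intervalIntegral.integral_add (i (by fun_prop)) (i (by fun_prop)),
    ← intervalIntegral.integral_sub (i (by fun_prop)) (i (by fun_prop)),
    ← intervalIntegral.integral_div]
  refine intervalIntegral.integral_mono_on (by norm_num) (i (by fun_prop)) (i (by fun_prop))
    fun x _ => ?_
  have h1 := mul_le_mul_of_nonneg_right
    (le_max_left (defect H ε ((3 * L + B) * η) a b v τ k x) 0) (hφ0 x)
  have h2 : (supConv ε (v τ) x * φ x - supConv ε (v (τ - k)) x * φ x) / k =
      defect H ε ((3 * L + B) * η) a b v τ k x * φ x
        + discreteOp (a τ x) H k (supConv ε (v τ)) x * φ x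
        + b τ x * supConv ε (v τ) x * φ x + (3 * L + B) * η * φ x := by
    simp only [defect]; ring
  rw [h2]
  linarith

end IsLinearSolution
end

section
open Set Filter Topology intervalIntegral

theorem continuous_integral_slice {w : ℝ → ℝ → ℝ} (hw : Continuous (Function.uncurry w)) (p q : ℝ) :
    Continuous fun τ => ∫ x in p..q, w τ x :=
  intervalIntegral.continuous_parametric_intervalIntegral_of_continuous' hw p q

theorem integral_add_const {f : ℝ → ℝ} (hf : Continuous f) (c s t : ℝ) :
    ∫ τ in s..t, (f τ + c) = (∫ τ in s..t, f τ) + (t - s) * c := by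
  rw [intervalIntegral.integral_add (hf.intervalIntegrable _ _) (by simp),
    intervalIntegral.integral_const, smul_eq_mul]

theorem IsTestFunction.add_const {φ φ₁ φ₂ : ℝ → ℝ} (h : IsTestFunction φ φ₁ φ₂) (K : ℝ) :
    IsTestFunction (fun x => φ x + K) φ₁ φ₂ where
  periodic x := congrArg (· + K) (h.periodic x)
  hasDerivAt x := (h.hasDerivAt x).add_const K
  hasDerivAt₁ := h.hasDerivAt₁
  continuous₂ := h.continuous₂

theorem isTestFunction_const (K : ℝ) : IsTestFunction (fun _ => K) 0 0 where
  periodic _ := rfl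
  hasDerivAt x := hasDerivAt_const x K
  hasDerivAt₁ x := hasDerivAt_const x 0
  continuous₂ := continuous_const

namespace IsLinearSolution

variable {H s t : ℝ} {a b v v₁ v₂ : ℝ → ℝ → ℝ} {φ φ₁ φ₂ : ℝ → ℝ}

theorem neg (hs : IsLinearSolution H a b v v₁ v₂) :
    IsLinearSolution H a b (fun t x => -v t x) (fun t x => -v₁ t x) (fun t x => -v₂ t x) where
  continuous_a := hs.continuous_a
  continuous_b := hs.continuous_b
  continuous_v := hs.continuous_v.neg
  periodic_a := hs.periodic_a
  periodic_b := hs.periodic_b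
  periodic_v t ht x := congrArg Neg.neg (hs.periodic_v t ht x)
  hasDerivAt_a := hs.hasDerivAt_a
  hasDerivAt_v t ht x := (hs.hasDerivAt_v t ht x).neg
  hasDerivAt_v₁ t ht x := (hs.hasDerivAt_v₁ t ht x).neg
  hasDerivAt_time t ht x := by
    refine (hs.hasDerivAt_time t ht x).neg.congr_deriv ?_
    ring

theorem exists_supConvControl (hs : IsLinearSolution H a b v v₁ v₂) (h0 : 0 < s) :
    ∃ A L B : ℝ, 0 ≤ A ∧ ∀ η > 0, ∃ δ ε, SupConvControl a b v s t A L B η δ ε := by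
  have hp : ∀ τ ∈ Icc s t, 0 < τ := fun τ hτ => h0.trans_le hτ.1
  obtain ⟨A, hA, hA'⟩ := exists_bound_of_periodic hs.continuous_a
    fun τ hτ => hs.periodic_a τ (hp τ hτ)
  obtain ⟨L, hL, hL'⟩ := exists_bound_of_periodic hs.continuous_b
    fun τ hτ => hs.periodic_b τ (hp τ hτ)
  obtain ⟨B, hB, hB'⟩ := exists_bound_of_periodic hs.continuous_v
    fun τ hτ => hs.periodic_v τ (hp τ hτ)
  refine ⟨A, L, B, hA.le, fun η hη => ?_⟩
  obtain ⟨δ₁, hδ₁, hm₁⟩ := exists_modulus_of_periodic hs.continuous_b hη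
    fun τ hτ => hs.periodic_b τ (hp τ hτ)
  obtain ⟨δ₂, hδ₂, hm₂⟩ := exists_modulus_of_periodic hs.continuous_v hη
    fun τ hτ => hs.periodic_v τ (hp τ hτ)
  have hδ : 0 < min (min δ₁ δ₂) (1 / 2) := by positivity
  refine ⟨min (min δ₁ δ₂) (1 / 2), (min (min δ₁ δ₂) (1 / 2)) ^ 2 / (4 * B), ?_⟩
  exact {
    pos := h0
    ε_pos := by positivity
    δ_nonneg := hδ.le
    δ_le := min_le_right _ _
    scale := by rw [mul_div_cancel₀ _ (by positivity)]
    bound_a := hA'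
    bound_b := hL'
    bound_v := hB'
    modulus_b := fun τ hτ x z hz =>
      hm₁ τ hτ x z (hz.trans ((min_le_left _ _).trans (min_le_left _ _)))
    modulus_v := fun τ hτ x z hz =>
      hm₂ τ hτ x z (hz.trans ((min_le_left _ _).trans (min_le_right _ _))) }

theorem weak_le (hH : 0 < H) (hs : IsLinearSolution H a b v v₁ v₂) (hφ : IsTestFunction φ φ₁ φ₂)
    (hφ0 : ∀ x, 0 ≤ φ x) (h0 : 0 < s) (hst : s ≤ t) :
    (∫ x in (-1 : ℝ)..1, v t x * φ x) - (∫ x in (-1 : ℝ)..1, v s x * φ x) ≤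
      ∫ τ in s..t, ∫ x in (-1 : ℝ)..1, v τ x * (H * φ₂ x - a τ x * φ₁ x) := by
  have hva := hs.continuous_a
  have hvc := hs.continuous_v
  have hφc := hφ.continuous
  have hφ₁c := hφ.continuous₁
  have hφ₂c := hφ.continuous₂
  have hvs := fun τ => hs.continuous_slice τ
  have i : ∀ {p q : ℝ} {f : ℝ → ℝ}, Continuous f → IntervalIntegrable f volume p q := fun h =>
    h.intervalIntegrable _ _
  obtain ⟨A, L, B, hA, hctl⟩ := hs.exists_supConvControl (t := t) h0
  have hwc : Continuous (Function.uncurry fun τ x => H * φ₂ x - a τ x * φ₁ x) := by fun_prop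
  obtain ⟨K, hK, hK'⟩ := exists_bound_of_periodic (s := s) (t := t) hwc fun τ hτ x => by
    simp only [hφ.periodic₁ x, hφ.periodic₂ x, hs.periodic_a τ (h0.trans_le hτ.1) x]
  have hq : Continuous fun τ => ∫ x in (-1 : ℝ)..1, v τ x * (H * φ₂ x - a τ x * φ₁ x) :=
    continuous_integral_slice (by fun_prop) _ _
  set P := ∫ x in (-1 : ℝ)..1, φ x with hP
  set C := P + (t - s) * (2 * K + (3 * L + B) * P) with hC
  have step : ∀ η > 0, (∫ x in (-1 : ℝ)..1, v t x * φ x) - (∫ x in (-1 : ℝ)..1, v s x * φ x) ≤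
      (∫ τ in s..t, ∫ x in (-1 : ℝ)..1, v τ x * (H * φ₂ x - a τ x * φ₁ x)) + C * η := by
    intro η hη
    obtain ⟨δ, ε, hc⟩ := hctl η hη
    have hS := supConv_continuous (ε := ε) hs.continuous_v
    have hSs := fun τ => hs.continuous_supConv (ε := ε) τ
    have hqε : Continuous fun τ =>
        ∫ x in (-1 : ℝ)..1, supConv ε (v τ) x * (H * φ₂ x - a τ x * φ₁ x) :=
      continuous_integral_slice (w := fun τ x => supConv ε (v τ) x * (H * φ₂ x - a τ x * φ₁ x))
        (hS.mul hwc) _ _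
    have hm : Continuous fun τ => ∫ x in (-1 : ℝ)..1, supConv ε (v τ) x * φ x :=
      continuous_integral_slice (w := fun τ x => supConv ε (v τ) x * φ x)
        (hS.mul (hφc.comp continuous_snd)) _ _
    have main := sub_le_integral_of_left_dini
      (g := fun τ => (∫ x in (-1 : ℝ)..1, supConv ε (v τ) x * (H * φ₂ x - a τ x * φ₁ x)) +
        (3 * L + B) * η * P) hst hm (hqε.add continuous_const)
      fun τ hτ r hr => hs.supConv_left_dini hH hA hη.le hc hφ hφ0 hτ hr
    have e1 : (∫ x in (-1 : ℝ)..1, v t x * φ x) ≤ ∫ x in (-1 : ℝ)..1, supConv ε (v t) x * φ x :=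
      intervalIntegral.integral_mono_on (by norm_num) (i ((hvs t).mul hφc)) (i ((hSs t).mul hφc))
        fun x _ => mul_le_mul_of_nonneg_right (le_supConv (hvs t) x) (hφ0 x)
    have e2 : (∫ x in (-1 : ℝ)..1, supConv ε (v s) x * φ x) ≤
        (∫ x in (-1 : ℝ)..1, v s x * φ x) + η * P := by
      rw [hP, ← intervalIntegral.integral_const_mul,
        ← intervalIntegral.integral_add (i (by fun_prop)) (i (by fun_prop))]
      refine intervalIntegral.integral_mono_on (by norm_num) (i ((hSs s).mul hφc))
        (i (by fun_prop)) fun x _ => ?_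
      have := mul_le_mul_of_nonneg_right (hs.supConv_le hc ⟨le_rfl, hst⟩ x) (hφ0 x)
      linarith
    have e3 : ∀ τ ∈ Icc s t,
        (∫ x in (-1 : ℝ)..1, supConv ε (v τ) x * (H * φ₂ x - a τ x * φ₁ x)) ≤
        (∫ x in (-1 : ℝ)..1, v τ x * (H * φ₂ x - a τ x * φ₁ x)) + 2 * K * η := by
      intro τ hτ
      have hwτ : Continuous fun x => H * φ₂ x - a τ x * φ₁ x :=
        hwc.comp (Continuous.prodMk_right τ)
      have e : 2 * K * η = ∫ x in (-1 : ℝ)..1, η * K := by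
        rw [intervalIntegral.integral_const, smul_eq_mul]; ring
      rw [e, ← intervalIntegral.integral_add (i (by fun_prop)) (i (by fun_prop))]
      refine intervalIntegral.integral_mono_on (by norm_num) (i ((hSs τ).mul hwτ))
        (i (((hvs τ).mul hwτ).add continuous_const)) fun x _ => ?_
      have k1 := le_supConv (ε := ε) (hvs τ) x
      have k2 := hs.supConv_le hc hτ x
      have k3 : (supConv ε (v τ) x - v τ x) * (H * φ₂ x - a τ x * φ₁ x) ≤ η * K := by
        refine (le_abs_self _).trans ?_
        rw [abs_mul, abs_of_nonneg (by linarith)]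
        exact mul_le_mul (by linarith) (hK' τ hτ x) (abs_nonneg _) hη.le
      linarith
    have e4 := intervalIntegral.integral_mono_on
      (g := fun τ => (∫ x in (-1 : ℝ)..1, v τ x * (H * φ₂ x - a τ x * φ₁ x)) + 2 * K * η)
      hst (i hqε) (i (hq.add (continuous_const (y := 2 * K * η)))) e3
    rw [integral_add_const hq] at e4
    rw [integral_add_const hqε] at main
    rw [hC]
    linarith
  have hlim : Tendsto (fun η : ℝ => (∫ τ in s..t, ∫ x in (-1 : ℝ)..1,
      v τ x * (H * φ₂ x - a τ x * φ₁ x)) + C * η) (𝓝[>] 0)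
      (𝓝 ((∫ τ in s..t, ∫ x in (-1 : ℝ)..1, v τ x * (H * φ₂ x - a τ x * φ₁ x)) + C * 0)) :=
    tendsto_nhdsWithin_of_tendsto_nhds (Continuous.tendsto (by fun_prop) 0)
  rw [mul_zero, add_zero] at hlim
  exact ge_of_tendsto hlim (by filter_upwards [self_mem_nhdsWithin] with η hη using step η hη)

theorem weak_eq_of_nonneg (hH : 0 < H) (hs : IsLinearSolution H a b v v₁ v₂)
    (hφ : IsTestFunction φ φ₁ φ₂) (hφ0 : ∀ x, 0 ≤ φ x) (h0 : 0 < s) (hst : s ≤ t) :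
    (∫ x in (-1 : ℝ)..1, v t x * φ x) - (∫ x in (-1 : ℝ)..1, v s x * φ x) =
      ∫ τ in s..t, ∫ x in (-1 : ℝ)..1, v τ x * (H * φ₂ x - a τ x * φ₁ x) := by
  refine le_antisymm (hs.weak_le hH hφ hφ0 h0 hst) ?_
  have := hs.neg.weak_le hH hφ hφ0 h0 hst
  simp only [neg_mul, intervalIntegral.integral_neg] at this
  linarith

/-- A pointwise solution is a distributional solution. -/
theorem weak_eq (hH : 0 < H) (hs : IsLinearSolution H a b v v₁ v₂)
    (hφ : IsTestFunction φ φ₁ φ₂) (h0 : 0 < s) (hst : s ≤ t) :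
    (∫ x in (-1 : ℝ)..1, v t x * φ x) - (∫ x in (-1 : ℝ)..1, v s x * φ x) =
      ∫ τ in s..t, ∫ x in (-1 : ℝ)..1, v τ x * (H * φ₂ x - a τ x * φ₁ x) := by
  obtain ⟨K, hK, hK'⟩ := exists_bound_of_continuous_periodic hφ.continuous hφ.periodic
  have h1 := hs.weak_eq_of_nonneg hH (hφ.add_const K)
    (fun x => by linarith [(abs_le.1 (hK' x)).1]) h0 hst
  have h2 := hs.weak_eq_of_nonneg hH (isTestFunction_const K) (fun _ => hK.le) h0 hst
  have hc := hφ.continuous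
  have e : ∀ τ, ∫ x in (-1 : ℝ)..1, v τ x * (φ x + K) =
      (∫ x in (-1 : ℝ)..1, v τ x * φ x) + ∫ x in (-1 : ℝ)..1, v τ x * K := fun τ => by
    have := hs.continuous_slice τ
    rw [← intervalIntegral.integral_add
      (Continuous.intervalIntegrable (by fun_prop) _ _)
      (Continuous.intervalIntegrable (by fun_prop) _ _)]
    simp only [mul_add]
  simp only [e] at h1
  simp only [Pi.zero_apply, mul_zero, sub_zero, intervalIntegral.integral_zero] at h2
  linarith

end IsLinearSolution
end

section
open Set Filter Topology intervalIntegral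

theorem sq_mul_integral_sq_le_of_lt_pi {U u : ℝ → ℝ} (hU : ∀ x, HasDerivAt U (u x) x)
    (hu : Continuous u) (h0 : U 0 = 0) (h1 : U 1 = 0) {β : ℝ} (hβ0 : 0 < β) (hβ : β < π) :
    β ^ 2 * ∫ x in (0 : ℝ)..1, U x ^ 2 ≤ ∫ x in (0 : ℝ)..1, u x ^ 2 := by
  have hUc : Continuous U := continuous_iff_continuousAt.2 fun x => (hU x).continuousAt
  have hcos : ∀ x ∈ Icc (0 : ℝ) 1, cos (β * (x - 1 / 2)) ≠ 0 := fun x hx =>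
    (cos_pos_of_mem_Ioo ⟨by nlinarith [hx.1], by nlinarith [hx.2]⟩).ne'
  have hd : ∀ x ∈ Icc (0 : ℝ) 1, HasDerivAt (fun x => -β * (tan (β * (x - 1 / 2)) * U x ^ 2))
      (-β * (1 / cos (β * (x - 1 / 2)) ^ 2 * β * U x ^ 2 +
        tan (β * (x - 1 / 2)) * (2 * U x * u x))) x := fun x hx => by
    have k1 : HasDerivAt (fun x => β * (x - 1 / 2)) β x := by
      exact (((hasDerivAt_id x).sub_const (1 / 2)).const_mul β).congr_deriv (mul_one β)
    have k2 := (Real.hasDerivAt_tan (hcos x hx)).comp x k1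
    have k3 : HasDerivAt (fun x => U x ^ 2) (2 * U x * u x) x := by
      exact ((hU x).pow 2).congr_deriv (by simp)
    exact (k2.mul k3).const_mul (-β)
  have key := intervalIntegral.sub_le_integral_of_hasDeriv_right_of_le (a := 0) (b := 1)
    (φ := fun x => u x ^ 2 - β ^ 2 * U x ^ 2) (by norm_num)
    (fun x hx => (hd x hx).continuousAt.continuousWithinAt)
    (fun x hx => (hd x ⟨hx.1.le, hx.2.le⟩).hasDerivWithinAt)
    (Continuous.integrableOn_Icc (by fun_prop)) (fun x hx => ?_)
  · rw [intervalIntegral.integral_sub (Continuous.intervalIntegrable (by fun_prop) _ _)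
      (Continuous.intervalIntegrable (by fun_prop) _ _), intervalIntegral.integral_const_mul, h0,
      h1] at key
    simp only [ne_eq, OfNat.ofNat_ne_zero, not_false_eq_true, zero_pow, mul_zero, sub_zero] at key
    linarith
  · have hc := hcos x ⟨hx.1.le, hx.2.le⟩
    have e : 1 / cos (β * (x - 1 / 2)) ^ 2 = 1 + tan (β * (x - 1 / 2)) ^ 2 := by
      rw [tan_eq_sin_div_cos, div_pow, one_add_div (pow_ne_zero 2 hc), cos_sq_add_sin_sq]
    rw [e]
    nlinarith [sq_nonneg (u x + β * tan (β * (x - 1 / 2)) * U x)]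

/-- Wirtinger's inequality with Dirichlet boundary conditions. -/
theorem pi_sq_mul_integral_sq_le_of_zero {U u : ℝ → ℝ} (hU : ∀ x, HasDerivAt U (u x) x)
    (hu : Continuous u) (h0 : U 0 = 0) (h1 : U 1 = 0) :
    π ^ 2 * ∫ x in (0 : ℝ)..1, U x ^ 2 ≤ ∫ x in (0 : ℝ)..1, u x ^ 2 := by
  have hlim : Tendsto (fun β : ℝ => β ^ 2 * ∫ x in (0 : ℝ)..1, U x ^ 2) (𝓝[<] π)
      (𝓝 (π ^ 2 * ∫ x in (0 : ℝ)..1, U x ^ 2)) :=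
    tendsto_nhdsWithin_of_tendsto_nhds (Continuous.tendsto (by fun_prop) π)
  refine le_of_tendsto hlim ?_
  filter_upwards [Ioo_mem_nhdsLT pi_pos] with β hβ
  exact sq_mul_integral_sq_le_of_lt_pi hU hu h0 h1 hβ.1 hβ.2

/-- The Poincaré–Wirtinger inequality on the unit interval. -/
theorem pi_sq_mul_integral_sq_le_of_mean_zero {u u' : ℝ → ℝ} (hd : ∀ x, HasDerivAt u (u' x) x)
    (hu' : Continuous u') (hmean : ∫ x in (0 : ℝ)..1, u x = 0) :
    π ^ 2 * ∫ x in (0 : ℝ)..1, u x ^ 2 ≤ ∫ x in (0 : ℝ)..1, u' x ^ 2 := by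
  have hu : Continuous u := continuous_iff_continuousAt.2 fun x => (hd x).continuousAt
  have hU : ∀ x, HasDerivAt (fun x => ∫ y in (0 : ℝ)..x, u y) (u x) x := fun x =>
    (hu.integral_hasStrictDerivAt 0 x).hasDerivAt
  have hW := pi_sq_mul_integral_sq_le_of_zero hU hu (by simp) hmean
  set U : ℝ → ℝ := fun x => ∫ y in (0 : ℝ)..x, u y with hUdef
  have hUc : Continuous U := continuous_iff_continuousAt.2 fun x => (hU x).continuousAt
  have hparts := intervalIntegral.integral_mul_deriv_eq_deriv_mul (a := 0) (b := 1)
    (fun x _ => hd x) (fun x _ => hU x) (hu'.intervalIntegrable _ _) (hu.intervalIntegrable _ _)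
  have hU1 : U 1 = 0 := hmean
  have hU0 : U 0 = 0 := by simp [hUdef]
  rw [hU1, hU0] at hparts
  have hsq := intervalIntegral.integral_nonneg (a := 0) (b := 1)
    (μ := volume)
    (f := fun x => (u' x + π ^ 2 * U x) ^ 2) (by norm_num) (fun x _ => sq_nonneg _)
  have e : (∫ x in (0 : ℝ)..1, (u' x + π ^ 2 * U x) ^ 2) = (∫ x in (0 : ℝ)..1, u' x ^ 2) +
      2 * π ^ 2 * (∫ x in (0 : ℝ)..1, u' x * U x) + π ^ 4 * ∫ x in (0 : ℝ)..1, U x ^ 2 := by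
    rw [← intervalIntegral.integral_const_mul, ← intervalIntegral.integral_const_mul,
      ← intervalIntegral.integral_add (Continuous.intervalIntegrable (by fun_prop) _ _)
      (Continuous.intervalIntegrable (by fun_prop) _ _),
      ← intervalIntegral.integral_add (Continuous.intervalIntegrable (by fun_prop) _ _)
      (Continuous.intervalIntegrable (by fun_prop) _ _)]
    congr 1; ext x; ring
  have e2 : (∫ x in (0 : ℝ)..1, u x * u x) = ∫ x in (0 : ℝ)..1, u x ^ 2 := by
    simp only [sq]
  rw [e2] at hparts
  have := mul_le_mul_of_nonneg_left hW (sq_nonneg π)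
  nlinarith

theorem integral_neg_one_one_of_even {f : ℝ → ℝ} (hf : Continuous f) (he : ∀ x, f (-x) = f x) :
    ∫ x in (-1 : ℝ)..1, f x = 2 * ∫ x in (0 : ℝ)..1, f x := by
  have h1 : ∫ x in (-1 : ℝ)..0, f x = ∫ x in (0 : ℝ)..1, f x := by
    have := intervalIntegral.integral_comp_neg (a := 0) (b := 1) f
    simp only [he, neg_zero] at this
    exact this.symm
  rw [← intervalIntegral.integral_add_adjacent_intervals (hf.intervalIntegrable (-1) 0)
    (hf.intervalIntegrable 0 1), h1]
  ring

/-- The Poincaré inequality for even functions of mean zero on `[-1, 1]`. -/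
theorem pi_sq_mul_integral_sq_le_of_even {u u' : ℝ → ℝ} (hd : ∀ x, HasDerivAt u (u' x) x)
    (hu' : Continuous u') (he : ∀ x, u (-x) = u x) (hmean : ∫ x in (0 : ℝ)..1, u x = 0) :
    π ^ 2 * ∫ x in (-1 : ℝ)..1, u x ^ 2 ≤ ∫ x in (-1 : ℝ)..1, u' x ^ 2 := by
  have hu : Continuous u := continuous_iff_continuousAt.2 fun x => (hd x).continuousAt
  have ho : ∀ x, u' (-x) = -u' x := fun x => by
    have h1 : HasDerivAt (fun x => u (-x)) (u' (-x) * -1) x :=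
      (hd (-x)).comp x (hasDerivAt_neg x)
    simp only [he] at h1
    linarith [h1.unique (hd x)]
  rw [integral_neg_one_one_of_even (by fun_prop) fun x => by rw [he],
    integral_neg_one_one_of_even (by fun_prop) fun x => by rw [ho, neg_sq]]
  linarith [pi_sq_mul_integral_sq_le_of_mean_zero hd hu' hmean]
end

section
open Set Filter Topology intervalIntegral

theorem IsLinearSolution.energy_left_dini {H τ r : ℝ} {a b v v₁ v₂ : ℝ → ℝ → ℝ} {g φ₁ φ₂ : ℝ → ℝ}
    (hH : 0 < H) (hs : IsLinearSolution H a b v v₁ v₂) (hg : Continuous g) (hτ : 0 < τ)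
    (hφ : IsTestFunction (fun x => v τ x - g x) φ₁ φ₂)
    (hr : 2 * (∫ x in (-1 : ℝ)..1, v τ x * (H * φ₂ x - a τ x * φ₁ x)) < r) :
    ∃ᶠ k in 𝓝[>] (0 : ℝ), ((∫ x in (-1 : ℝ)..1, (v τ x - g x) ^ 2) -
      ∫ x in (-1 : ℝ)..1, (v (τ - k) x - g x) ^ 2) / k < r := by
  have hva := hs.continuous_a
  have hvc := hs.continuous_v
  have hφ₁c := hφ.continuous₁
  have hφ₂c := hφ.continuous₂
  have hvs := fun τ => hs.continuous_slice τ
  have i : ∀ {p q : ℝ} {f : ℝ → ℝ}, Continuous f → IntervalIntegrable f volume p q := fun h =>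
    h.intervalIntegrable _ _
  have hq : Continuous fun τ => ∫ x in (-1 : ℝ)..1, v τ x * (H * φ₂ x - a τ x * φ₁ x) :=
    continuous_integral_slice (by fun_prop) _ _
  have hlim := (tendsto_left_quotient (hq.integral_hasStrictDerivAt 0 τ).hasDerivAt).const_mul 2
  refine Eventually.frequently ?_
  filter_upwards [hlim.eventually_lt_const hr, Ioo_mem_nhdsGT hτ] with k hk hk0
  refine lt_of_le_of_lt ?_ hk
  rw [← mul_div_assoc, div_le_div_iff_of_pos_right hk0.1,
    intervalIntegral.integral_interval_sub_left (i hq) (i hq),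
    ← hs.weak_eq hH hφ (by linarith [hk0.2]) (by linarith [hk0.1])]
  have h1 := hvs τ
  have h2 := hvs (τ - k)
  rw [← intervalIntegral.integral_sub (i (by fun_prop)) (i (by fun_prop)),
    ← intervalIntegral.integral_sub (i (by fun_prop)) (i (by fun_prop)),
    ← intervalIntegral.integral_const_mul]
  refine intervalIntegral.integral_mono_on (by norm_num) (i (by fun_prop)) (i (by fun_prop))
    fun x _ => ?_
  nlinarith [sq_nonneg (v τ x - v (τ - k) x)]

theorem window_sq_le {f : ℝ → ℝ} (hf : Continuous f) {R : ℝ} (hR : 0 < R) (x : ℝ) :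
    (∫ y in (x - R)..(x + R), (x - y) * f y) ^ 2 ≤
      2 * R ^ 3 / 3 * ∫ z in (-R)..R, f (x + z) ^ 2 := by
  rw [window_shift]
  obtain ⟨k, hk⟩ : ∃ k, k = ∫ z in (-R)..R, -z * f (x + z) := ⟨_, rfl⟩
  rw [← hk]
  set m := 2 * R ^ 3 / 3 with hm
  have hm0 : 0 < m := by positivity
  have hsq := intervalIntegral.integral_nonneg (a := -R) (b := R) (μ := volume)
    (f := fun z => (m * f (x + z) + k * z) ^ 2) (by linarith) (fun z _ => sq_nonneg _)
  have e : (∫ z in (-R)..R, (m * f (x + z) + k * z) ^ 2) =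
      m ^ 2 * (∫ z in (-R)..R, f (x + z) ^ 2) + (-2 * m * k) * (∫ z in (-R)..R, -z * f (x + z)) +
        k ^ 2 * ∫ z in (-R)..R, z ^ 2 := by
    rw [← intervalIntegral.integral_const_mul, ← intervalIntegral.integral_const_mul,
      ← intervalIntegral.integral_const_mul,
      ← intervalIntegral.integral_add (Continuous.intervalIntegrable (by fun_prop) _ _)
      (Continuous.intervalIntegrable (by fun_prop) _ _),
      ← intervalIntegral.integral_add (Continuous.intervalIntegrable (by fun_prop) _ _)
      (Continuous.intervalIntegrable (by fun_prop) _ _)]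
    congr 1; ext z; ring
  have e2 : ∫ z in (-R)..R, z ^ 2 = m := by
    rw [integral_pow, hm]; push_cast; ring
  rw [e, e2, ← hk] at hsq
  have : 0 ≤ m * (m * (∫ z in (-R)..R, f (x + z) ^ 2) - k ^ 2) := by linarith
  linarith [nonneg_of_mul_nonneg_right this hm0]

theorem integral_window_sq_le {f : ℝ → ℝ} (hf : Continuous f) (hp : Function.Periodic f 2) {R : ℝ}
    (hR : 0 < R) :
    (∫ x in (-1 : ℝ)..1, (∫ y in (x - R)..(x + R), (x - y) * f y) ^ 2) ≤
      (2 * R ^ 2 / √3) ^ 2 * ∫ x in (-1 : ℝ)..1, f x ^ 2 := by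
  have hw := window_continuous (fun a b => hf.intervalIntegrable a b) R
  have hc : Continuous fun x => ∫ z in (-R)..R, f (x + z) ^ 2 :=
    continuous_integral_slice (w := fun x z => f (x + z) ^ 2) (by fun_prop) _ _
  have h1 := intervalIntegral.integral_mono_on (a := -1) (b := 1) (μ := volume)
    (f := fun x => (∫ y in (x - R)..(x + R), (x - y) * f y) ^ 2)
    (g := fun x => 2 * R ^ 3 / 3 * ∫ z in (-R)..R, f (x + z) ^ 2) (by norm_num)
    ((hw.pow 2).intervalIntegrable _ _) ((hc.const_mul _).intervalIntegrable _ _)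
    fun x _ => window_sq_le hf hR x
  have h2 : (∫ x in (-1 : ℝ)..1, ∫ z in (-R)..R, f (x + z) ^ 2) =
      2 * R * ∫ x in (-1 : ℝ)..1, f x ^ 2 := by
    rw [intervalIntegral_intervalIntegral_swap
      ((Continuous.continuousOn (by fun_prop)).integrableOn_compact
        (isCompact_uIcc.prod isCompact_uIcc) |>.mono_set
        (prod_mono uIoc_subset_uIcc uIoc_subset_uIcc))]
    have h3 : ∀ z, ∫ x in (-1 : ℝ)..1, f (x + z) ^ 2 = ∫ x in (-1 : ℝ)..1, f x ^ 2 := fun z => by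
      have := integral_shift_mul (f := fun x => f x ^ 2) (g := fun _ => 1)
        (fun x => by simp only [hp x]) (fun _ => rfl) z
      simpa using this
    simp only [h3, intervalIntegral.integral_const, smul_eq_mul]
    ring
  rw [intervalIntegral.integral_const_mul, h2] at h1
  refine h1.trans (le_of_eq ?_)
  rw [div_pow, Real.sq_sqrt (by norm_num)]
  ring

theorem integral_deriv_mul_periodic {f f' g g' : ℝ → ℝ} (hf : ∀ x, HasDerivAt f (f' x) x)
    (hg : ∀ x, HasDerivAt g (g' x) x) (hf' : Continuous f') (hg' : Continuous g')
    (hfp : Function.Periodic f 2) (hgp : Function.Periodic g 2) :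
    ∫ x in (-1 : ℝ)..1, f x * g' x = -∫ x in (-1 : ℝ)..1, f' x * g x := by
  rw [intervalIntegral.integral_mul_deriv_eq_deriv_mul (fun x _ => hf x) (fun x _ => hg x)
    (hf'.intervalIntegrable _ _) (hg'.intervalIntegrable _ _)]
  have h1 := hfp (-1)
  have h2 := hgp (-1)
  rw [show (-1 : ℝ) + 2 = 1 by norm_num] at h1 h2
  rw [h1, h2]; ring

/-- The energy dissipation estimate for a perturbation `φ` of a stationary profile `g`. -/
theorem dissipation_le {R H A₀ S : ℝ} {φ φ₁ φ₂ g g' a γ : ℝ → ℝ} (hR : 0 < R) (hH : 0 < H)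
    (hA₀ : 0 < A₀) (hS : 0 ≤ S) (hφ : IsTestFunction φ φ₁ φ₂) (he : ∀ x, φ (-x) = φ x)
    (hmean : ∫ x in (0 : ℝ)..1, φ x = 0) (hg : ∀ x, HasDerivAt g (g' x) x) (hg' : Continuous g')
    (hgp : Function.Periodic g 2) (hg0 : ∀ x, 0 ≤ g x) (hgS : ∀ x, g x ≤ S) (hγ : Continuous γ)
    (hflux : ∀ x, H * g' x + g x * γ x = 0)
    (ha : ∀ x, a x = γ x + ∫ y in (x - R)..(x + R), (x - y) * φ y) (haA : ∀ x, |a x| ≤ A₀) :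
    2 * (∫ x in (-1 : ℝ)..1, (φ x + g x) * (H * φ₂ x - a x * φ₁ x)) ≤
      ((A₀ + 2 * R ^ 2 / √3 * S) ^ 2 / H - π ^ 2 * H) * ∫ x in (-1 : ℝ)..1, φ x ^ 2 := by
  have hφc := hφ.continuous
  have hφ₁c := hφ.continuous₁
  have hφ₂c := hφ.continuous₂
  have hgc : Continuous g := continuous_iff_continuousAt.2 fun x => (hg x).continuousAt
  have i : ∀ {p q : ℝ} {f : ℝ → ℝ}, Continuous f → IntervalIntegrable f volume p q := fun h =>
    h.intervalIntegrable _ _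
  have hw := window_continuous (fun a b => hφc.intervalIntegrable a b) R
  have hwin := integral_window_sq_le hφc hφ.periodic hR
  set K : ℝ → ℝ := fun x => ∫ y in (x - R)..(x + R), (x - y) * φ y with hK
  have hac : Continuous a := by rw [funext ha]; exact hγ.add hw
  set κ := 2 * R ^ 2 / √3 with hκ
  have hκ0 : 0 < κ := by positivity
  have hpoin := pi_sq_mul_integral_sq_le_of_even hφ.hasDerivAt hφ₁c he hmean
  have p1 := integral_deriv_mul_periodic hφ.hasDerivAt hφ.hasDerivAt₁ hφ₁c hφ₂c hφ.periodic
    hφ.periodic₁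
  have p2 := integral_deriv_mul_periodic hg hφ.hasDerivAt₁ hg' hφ₂c hgp hφ.periodic₁
  have hsplit : (∫ x in (-1 : ℝ)..1, (φ x + g x) * (H * φ₂ x - a x * φ₁ x)) =
      -H * (∫ x in (-1 : ℝ)..1, φ₁ x ^ 2) -
        ∫ x in (-1 : ℝ)..1, (φ x * a x * φ₁ x + g x * K x * φ₁ x) := by
    have e1 : (∫ x in (-1 : ℝ)..1, (φ x + g x) * (H * φ₂ x - a x * φ₁ x)) =
        H * (∫ x in (-1 : ℝ)..1, φ x * φ₂ x) + H * (∫ x in (-1 : ℝ)..1, g x * φ₂ x) +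
        H * (∫ x in (-1 : ℝ)..1, g' x * φ₁ x) -
        ∫ x in (-1 : ℝ)..1, (φ x * a x * φ₁ x + g x * K x * φ₁ x) := by
      rw [← intervalIntegral.integral_const_mul, ← intervalIntegral.integral_const_mul,
        ← intervalIntegral.integral_const_mul,
        ← intervalIntegral.integral_add (i (by fun_prop)) (i (by fun_prop)),
        ← intervalIntegral.integral_add (i (by fun_prop)) (i (by fun_prop)),
        ← intervalIntegral.integral_sub (i (by fun_prop)) (i (by fun_prop))]
      congr 1; ext x
      linear_combination (-(φ₁ x)) * hflux x - g x * φ₁ x * ha x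
    rw [e1, p1, p2]
    simp only [sq]
    ring
  set C := A₀ + κ * S with hC
  have hC0 : 0 < C := by positivity
  have hyoung : -2 * (∫ x in (-1 : ℝ)..1, (φ x * a x * φ₁ x + g x * K x * φ₁ x)) ≤
      H * (∫ x in (-1 : ℝ)..1, φ₁ x ^ 2) + A₀ * C / H * (∫ x in (-1 : ℝ)..1, φ x ^ 2) +
        S * C / (H * κ) * ∫ x in (-1 : ℝ)..1, K x ^ 2 := by
    rw [← intervalIntegral.integral_const_mul, ← intervalIntegral.integral_const_mul,
      ← intervalIntegral.integral_const_mul, ← intervalIntegral.integral_const_mul,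
      ← intervalIntegral.integral_add (i (by fun_prop)) (i (by fun_prop)),
      ← intervalIntegral.integral_add (i (by fun_prop)) (i (by fun_prop))]
    refine intervalIntegral.integral_mono_on (by norm_num) (i (by fun_prop)) (i (by fun_prop))
      fun x _ => ?_
    have y : ∀ {c B s : ℝ}, |c| ≤ B → ∀ {ε : ℝ}, 0 < ε →
        -2 * (s * c * φ₁ x) ≤ B * (ε * φ₁ x ^ 2 + s ^ 2 / ε) := by
      intro c B s hc ε hε
      have h1 : 2 * |s * φ₁ x| ≤ ε * φ₁ x ^ 2 + s ^ 2 / ε := by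
        rw [← sq_abs (φ₁ x), ← sq_abs s, abs_mul, ← sub_nonneg]
        have : ε * |φ₁ x| ^ 2 + |s| ^ 2 / ε - 2 * (|s| * |φ₁ x|) = (ε * |φ₁ x| - |s|) ^ 2 / ε := by
          field_simp; ring
        rw [this]; positivity
      calc _ ≤ |-2 * (s * c * φ₁ x)| := le_abs_self _
        _ = |c| * (2 * |s * φ₁ x|) := by
          simp only [abs_mul, abs_neg, abs_two]; ring
        _ ≤ _ := mul_le_mul hc h1 (by positivity) ((abs_nonneg _).trans hc)
    have y1 := y (s := φ x) (haA x) (ε := H / C) (by positivity)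
    have y2 := y (s := K x) (c := g x) (B := S) (by rw [abs_of_nonneg (hg0 x)]; exact hgS x)
      (ε := κ * H / C) (by positivity)
    have e2 : A₀ * (H / C * φ₁ x ^ 2 + φ x ^ 2 / (H / C)) +
        S * (κ * H / C * φ₁ x ^ 2 + K x ^ 2 / (κ * H / C)) =
        H * φ₁ x ^ 2 + A₀ * C / H * φ x ^ 2 + S * C / (H * κ) * K x ^ 2 := by
      have : H * φ₁ x ^ 2 = (A₀ + κ * S) * (H / C) * φ₁ x ^ 2 := by
        rw [← hC]; field_simp
      rw [this]; field_simp
      ring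
    linarith
  have hfin : A₀ * C / H * (∫ x in (-1 : ℝ)..1, φ x ^ 2) +
      S * C / (H * κ) * (κ ^ 2 * ∫ x in (-1 : ℝ)..1, φ x ^ 2) =
      C ^ 2 / H * ∫ x in (-1 : ℝ)..1, φ x ^ 2 := by
    rw [show C ^ 2 / H = (A₀ + κ * S) * C / H by rw [← hC]; ring]
    field_simp
  have h3 := mul_le_mul_of_nonneg_left hwin (show 0 ≤ S * C / (H * κ) by positivity)
  have h4 := mul_le_mul_of_nonneg_left hpoin hH.le
  rw [hsplit]
  linarith
end

section
open Set Filter Topology intervalIntegral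

theorem continuous_window_slice {w : ℝ → ℝ → ℝ} (hw : Continuous (Function.uncurry w)) (R : ℝ) :
    Continuous (Function.uncurry fun t x => ∫ y in (x - R)..(x + R), (x - y) * w t y) := by
  have h : (Function.uncurry fun t x => ∫ y in (x - R)..(x + R), (x - y) * w t y) =
      fun p : ℝ × ℝ => ∫ z in (-R)..R, -z * w p.1 (p.2 + z) := by
    ext p
    exact window_shift (w p.1) R p.2
  rw [h]
  exact intervalIntegral.continuous_parametric_intervalIntegral_of_continuous' (by fun_prop) _ _

theorem window_periodic {h : ℝ → ℝ} (hp : Function.Periodic h 2) (R : ℝ) :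
    Function.Periodic (fun x => ∫ y in (x - R)..(x + R), (x - y) * h y) 2 := by
  intro x
  simp only [window_shift]
  congr 1; ext z
  rw [show x + 2 + z = x + z + 2 by ring, hp]

/-- A solution of the Fokker–Planck equation solves a linear equation, whose drift is a
perturbation of the drift of a stationary profile. -/
theorem IsClassicalSolution.isLinearSolution {R M σ : ℝ} {ρr ρs γ' : ℝ → ℝ} {ρ : ℝ → ℝ → ℝ}
    (hsol : IsClassicalSolution R M σ ρr ρ) (hρr : IsEvenPeriodicDensity ρr)
    (hdens : ∀ t : ℝ, 0 ≤ t → IsEvenPeriodicDensity (ρ t)) (hρsc : Continuous ρs)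
    (hρsd : IsEvenPeriodicDensity ρs) (hγ : ∀ x, HasDerivAt (G R M ρs ρr) (γ' x) x)
    (hγ' : Continuous γ') :
    IsLinearSolution (σ ^ 2 / 2)
      (fun t x => G R M ρs ρr x + ∫ y in (x - R)..(x + R), (x - y) * (ρ t y - ρs y))
      (fun t x => γ' x + ((∫ z in (-R)..R, (ρ t (x + z) - ρs (x + z))) -
        R * ((ρ t (x + R) - ρs (x + R)) + (ρ t (x - R) - ρs (x - R)))))
      ρ (fun t => deriv (ρ t)) (fun t => deriv (deriv (ρ t))) := by
  obtain ⟨hρc, htime, hspace, hpde⟩ := hsol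
  have hwc : Continuous (Function.uncurry fun t x => ρ t x - ρs x) := by fun_prop
  have hwp : ∀ t, 0 < t → Function.Periodic (fun x => ρ t x - ρs x) 2 := fun t ht x => by
    simp only [(hdens t ht.le).1 x, hρsd.1 x]
  have hda : ∀ t x, HasDerivAt
      (fun x => G R M ρs ρr x + ∫ y in (x - R)..(x + R), (x - y) * (ρ t y - ρs y))
      (γ' x + ((∫ z in (-R)..R, (ρ t (x + z) - ρs (x + z))) -
        R * ((ρ t (x + R) - ρs (x + R)) + (ρ t (x - R) - ρs (x - R))))) x := fun t x =>
    (hγ x).add (window_hasDerivAt (h := fun x => ρ t x - ρs x)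
      (hwc.comp (Continuous.prodMk_right t)) R x)
  have hd1 : ∀ t, 0 < t → ∀ x, HasDerivAt (ρ t) (deriv (ρ t) x) x := fun t ht x =>
    (((hspace t ht).differentiable (by norm_num)) x).hasDerivAt
  have hap : ∀ t, 0 < t → Function.Periodic
      (fun x => G R M ρs ρr x + ∫ y in (x - R)..(x + R), (x - y) * (ρ t y - ρs y)) 2 :=
    fun t ht => (G_periodic hρsd hρr).add (window_periodic (hwp t ht) R)
  refine ⟨?_, ?_, hρc, hap, fun t ht => (hap t ht).of_hasDerivAt (hda t),
    fun t ht => (hdens t ht.le).1, fun t _ => hda t, hd1, fun t ht x => ?_, fun t ht x => ?_⟩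
  · have h1 := G_continuous (R := R) (M := M) hρsd hρr
    exact (h1.comp continuous_snd).add (continuous_window_slice hwc R)
  · have h1 : Continuous fun p : ℝ × ℝ => ∫ z in (-R)..R, (ρ p.1 (p.2 + z) - ρs (p.2 + z)) :=
      intervalIntegral.continuous_parametric_intervalIntegral_of_continuous' (by fun_prop) _ _
    refine (hγ'.comp continuous_snd).add (h1.sub ?_)
    fun_prop
  · have h2 : ContDiff ℝ 1 (deriv (ρ t)) := by
      have : ContDiff ℝ (1 + 1) (ρ t) := by simpa [one_add_one_eq_two] using hspace t ht
      exact ((contDiff_succ_iff_deriv).1 this).2.2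
    exact ((h2.differentiable (by norm_num)) x).hasDerivAt
  · have h1 := ((htime t ht x).differentiableAt (by norm_num)).hasDerivAt
    have h2 : (fun y => ρ t y * G R M (ρ t) ρr y) = fun y => ρ t y *
        (G R M ρs ρr y + ∫ z in (y - R)..(y + R), (y - z) * (ρ t z - ρs z)) := by
      ext y
      rw [G_sub (hdens t ht.le) hρsd hρr]
    have h3 : HasDerivAt (fun y => ρ t y *
        (G R M ρs ρr y + ∫ z in (y - R)..(y + R), (y - z) * (ρ t z - ρs z))) _ x :=
      (hd1 t ht x).mul (hda t x)
    rw [hpde t ht x, h2, h3.deriv] at h1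
    refine h1.congr_deriv ?_
    ring

/-- The `L²` distance to a stationary profile satisfies a Grönwall estimate. -/
theorem IsClassicalSolution.energy_le {R M σ : ℝ} {ρr ρs : ℝ → ℝ} {ρ : ℝ → ℝ → ℝ}
    (hsol : IsClassicalSolution R M σ ρr ρ) (hR : 0 < R) (hR1 : R ≤ 1) (hM : 0 ≤ M) (hσ : 0 < σ)
    (hρr : IsEvenPeriodicDensity ρr) (hdens : ∀ t : ℝ, 0 ≤ t → IsEvenPeriodicDensity (ρ t))
    (hρs : ContDiff ℝ 2 ρs) (hρsd : IsEvenPeriodicDensity ρs)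
    (hstat : ∀ x : ℝ,
      σ ^ 2 / 2 * deriv (deriv ρs) x + deriv (fun y => ρs y * G R M ρs ρr y) x = 0)
    {t : ℝ} (ht : 0 ≤ t) :
    (∫ x in (-1 : ℝ)..1, (ρ t x - ρs x) ^ 2) ≤ (∫ x in (-1 : ℝ)..1, (ρ 0 x - ρs x) ^ 2) *
      exp (((2 * R * (1 + M) + 2 * R ^ 2 / √3 * exp (8 * R * (1 + M) / σ ^ 2)) ^ 2 / (σ ^ 2 / 2) -
        π ^ 2 * (σ ^ 2 / 2)) * t) := by
  have hH : 0 < σ ^ 2 / 2 := by positivity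
  have hflux := stationary_flux hρr hρs hρsd hstat
  have hexp := stationary_eq_exp hH hρs (G_continuous hρsd hρr) hflux
  have hpos := stationary_pos hρsd hexp
  have hle := stationary_le hR hR1 hM hH hρr hρs hρsd hexp
  rw [show 4 * R * (1 + M) / (σ ^ 2 / 2) = 8 * R * (1 + M) / σ ^ 2 by field_simp; ring] at hle
  have hρs1 : ContDiff ℝ 1 (deriv ρs) := by
    have : ContDiff ℝ (1 + 1) ρs := by simpa [one_add_one_eq_two] using hρs
    exact ((contDiff_succ_iff_deriv).1 this).2.2
  have hρsdiff : ∀ x, HasDerivAt ρs (deriv ρs x) x := fun x =>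
    ((hρs.differentiable (by norm_num)) x).hasDerivAt
  have hGs : ContDiff ℝ 1 (G R M ρs ρr) := by
    have h : G R M ρs ρr = fun x => -(σ ^ 2 / 2) * deriv ρs x / ρs x := by
      ext x
      rw [eq_div_iff (hpos x).ne']
      linarith [hflux x]
    rw [h]
    exact (contDiff_const.mul hρs1).div (hρs.of_le (by norm_num)) fun x => (hpos x).ne'
  have hlin := hsol.isLinearSolution hρr hdens hρs.continuous hρsd
    (fun x => ((hGs.differentiable (by norm_num)) x).hasDerivAt) (hGs.continuous_deriv le_rfl)
  have hρc := hsol.1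
  have hρsc := hρs.continuous
  have hE : Continuous fun τ => ∫ x in (-1 : ℝ)..1, (ρ τ x - ρs x) ^ 2 :=
    continuous_integral_slice (w := fun τ x => (ρ τ x - ρs x) ^ 2) (by fun_prop) _ _
  have htest : ∀ τ, 0 < τ → IsTestFunction (fun x => ρ τ x - ρs x)
      (fun x => deriv (ρ τ) x - deriv ρs x) (fun x => deriv (deriv (ρ τ)) x - deriv (deriv ρs) x) :=
    fun τ hτ => by
    have h2 : ContDiff ℝ 1 (deriv (ρ τ)) := by
      have : ContDiff ℝ (1 + 1) (ρ τ) := by simpa [one_add_one_eq_two] using hsol.2.2.1 τ hτ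
      exact ((contDiff_succ_iff_deriv).1 this).2.2
    exact {
      periodic := fun x => by simp only [(hdens τ hτ.le).1 x, hρsd.1 x]
      hasDerivAt := fun x => (hlin.hasDerivAt_v τ hτ x).sub (hρsdiff x)
      hasDerivAt₁ := fun x => (hlin.hasDerivAt_v₁ τ hτ x).sub
        ((hρs1.differentiable (by norm_num)) x).hasDerivAt
      continuous₂ := (h2.continuous_deriv le_rfl).sub (hρs1.continuous_deriv le_rfl) }
  obtain ⟨lam, hlam⟩ : ∃ lam, lam = (2 * R * (1 + M) +
      2 * R ^ 2 / √3 * exp (8 * R * (1 + M) / σ ^ 2)) ^ 2 / (σ ^ 2 / 2) - π ^ 2 * (σ ^ 2 / 2) :=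
    ⟨_, rfl⟩
  rw [← hlam]
  have hgron : ∀ s, 0 < s → s ≤ t → (∫ x in (-1 : ℝ)..1, (ρ t x - ρs x) ^ 2) ≤
      (∫ x in (-1 : ℝ)..1, (ρ s x - ρs x) ^ 2) * exp (lam * (t - s)) := by
    intro s hs hst
    refine le_exp_of_left_dini hst hE fun τ hτ r hr => ?_
    have hτ0 : 0 < τ := hs.trans hτ.1
    have hdτ := hdens τ hτ0.le
    refine hlin.energy_left_dini hH hρsc hτ0 (htest τ hτ0) (lt_of_le_of_lt ?_ hr)
    have hmean : ∫ x in (0 : ℝ)..1, (ρ τ x - ρs x) = 0 := by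
      rw [intervalIntegral.integral_sub (hdτ.intervalIntegrable _ _)
        (hρsd.intervalIntegrable _ _), hdτ.2.2.2, hρsd.2.2.2, sub_self]
    have := dissipation_le (A₀ := 2 * R * (1 + M)) hR hH (by positivity) (exp_pos _).le
      (htest τ hτ0) (fun x => by rw [hdτ.2.1, hρsd.2.1]) hmean hρsdiff hρs1.continuous hρsd.1
      hρsd.2.2.1 hle (G_continuous hρsd hρr) hflux (fun x => rfl)
      (fun x => by rw [← G_sub hdτ hρsd hρr]; exact abs_G_le hR hR1 hM hdτ hρr x)
    rw [hlam]
    simpa only [sub_add_cancel] using this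
  rcases ht.eq_or_lt with rfl | ht0
  · simp
  · have hlim : Tendsto (fun s => (∫ x in (-1 : ℝ)..1, (ρ s x - ρs x) ^ 2) * exp (lam * (t - s)))
        (𝓝[>] 0) (𝓝 ((∫ x in (-1 : ℝ)..1, (ρ 0 x - ρs x) ^ 2) * exp (lam * (t - 0)))) :=
      tendsto_nhdsWithin_of_tendsto_nhds
        (Continuous.tendsto (hE.mul (by fun_prop)) 0)
    rw [sub_zero] at hlim
    refine ge_of_tendsto hlim ?_
    filter_upwards [Ioo_mem_nhdsGT ht0] with s hs using hgron s hs.1 hs.2.le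
end

theorem stmt_2 (R M σ : ℝ) (hR : 0 < R) (hR1 : R ≤ 1) (hM : 0 ≤ M) (hσ : 0 < σ)
    (ρr : ℝ → ℝ) (hρr : IsEvenPeriodicDensity ρr)
    (ρ : ℝ → ℝ → ℝ) (hsol : IsClassicalSolution R M σ ρr ρ)
    (hdens : ∀ t : ℝ, 0 ≤ t → IsEvenPeriodicDensity (ρ t))
    (ρs : ℝ → ℝ) (hρs : ContDiff ℝ 2 ρs) (hρsd : IsEvenPeriodicDensity ρs)
    (hstat : ∀ x : ℝ,
      σ ^ 2 / 2 * deriv (deriv ρs) x + deriv (fun y => ρs y * G R M ρs ρr y) x = 0)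
    (Cstar : ℝ)
    (hC : Cstar = 2 * R * (3 + M)
        + (2 * R ^ 2 / Real.sqrt 3) * Real.exp (8 * R * (1 + M) / σ ^ 2)) :
    (∀ t : ℝ, 0 ≤ t →
      (∫ x in (-1:ℝ)..1, (ρ t x - ρs x) ^ 2)
        ≤ (∫ x in (-1:ℝ)..1, (ρ 0 x - ρs x) ^ 2)
            * Real.exp ((2 * Cstar ^ 2 / σ ^ 2 - π ^ 2 * σ ^ 2 / 2) * t)) ∧
    (2 * Cstar ^ 2 / σ ^ 2 < π ^ 2 * σ ^ 2 / 2 →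
      ∃ c : ℝ, ∃ lam : ℝ, 0 < lam ∧ ∀ t : ℝ, 0 ≤ t →
        (∫ x in (-1:ℝ)..1, (ρ t x - ρs x) ^ 2) ≤ c * Real.exp (-lam * t)) := by
  have hA : 0 ≤ 2 * R * (1 + M) + 2 * R ^ 2 / √3 * exp (8 * R * (1 + M) / σ ^ 2) := by
    positivity
  have hCle : (2 * R * (1 + M) + 2 * R ^ 2 / √3 * exp (8 * R * (1 + M) / σ ^ 2)) ^ 2 ≤
      Cstar ^ 2 := by
    refine pow_le_pow_left₀ hA ?_ 2
    rw [hC]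
    linarith
  have hrate : (2 * R * (1 + M) + 2 * R ^ 2 / √3 * exp (8 * R * (1 + M) / σ ^ 2)) ^ 2 /
      (σ ^ 2 / 2) - π ^ 2 * (σ ^ 2 / 2) ≤ 2 * Cstar ^ 2 / σ ^ 2 - π ^ 2 * σ ^ 2 / 2 := by
    have h := div_le_div_of_nonneg_right hCle (show 0 ≤ σ ^ 2 / 2 by positivity)
    have e : Cstar ^ 2 / (σ ^ 2 / 2) = 2 * Cstar ^ 2 / σ ^ 2 := by
      rw [div_div_eq_mul_div, mul_comm]
    linarith
  have hmain : ∀ t : ℝ, 0 ≤ t → (∫ x in (-1:ℝ)..1, (ρ t x - ρs x) ^ 2) ≤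
      (∫ x in (-1:ℝ)..1, (ρ 0 x - ρs x) ^ 2) *
        exp ((2 * Cstar ^ 2 / σ ^ 2 - π ^ 2 * σ ^ 2 / 2) * t) := fun t ht =>
    (hsol.energy_le hR hR1 hM hσ hρr hdens hρs hρsd hstat ht).trans
      (mul_le_mul_of_nonneg_left (exp_le_exp.2 (mul_le_mul_of_nonneg_right hrate ht))
        (intervalIntegral.integral_nonneg (by norm_num) fun x _ => sq_nonneg _))
  refine ⟨hmain, fun hlt => ⟨∫ x in (-1:ℝ)..1, (ρ 0 x - ρs x) ^ 2,
    π ^ 2 * σ ^ 2 / 2 - 2 * Cstar ^ 2 / σ ^ 2, sub_pos.2 hlt, fun t ht => ?_⟩⟩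
  rw [neg_sub]
  exact hmain t ht
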